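/- arXiv:2503.12371 — 3 statements merged into one kernel-verified Lean document; each statement's English description precedes it below -/
import Mathlib

section
/- Assume condition (h1) holds, and in addition: (h2) E is bounded from below on 𝒩; (h3) there exists C₁ > 0 such that |E''(u)(w₁, w₂)| ≤ C₁ for all u ∈ 𝒩 and all w₁, w₂ ∈ H with |w₁|_H = |w₂|_H = 1; (h4) there exists C₂ > 0 such that |E''(u)(u, u)| ≥ C₂ for all u ∈ 𝒩; and assume the set 𝒩 is closed in H. Then there exists a sequence {uₙ} ⊂ 𝒩 such that E(uₙ) → inf_{𝒩} E and |E'(uₙ)|_H → 0. -/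
open Filter Set
open scoped RealInnerProductSpace

/-- Weak form of Ekeland's variational principle. -/
theorem LowerSemicontinuous.exists_le_add_mul_dist {X : Type*} [MetricSpace X] [CompleteSpace X]
    {f : X → ℝ} (hf : LowerSemicontinuous f) (hbdd : BddBelow (range f)) {δ : ℝ} (hδ : 0 < δ)
    (x₀ : X) : ∃ y, f y ≤ f x₀ ∧ ∀ z, f y ≤ f z + δ * dist y z := by
  let S : X → Set X := fun x => {z | f z + δ * dist x z ≤ f x}
  have hself : ∀ x, x ∈ S x := fun x => by simp [S]
  have htrans : ∀ {x y z}, y ∈ S x → z ∈ S y → z ∈ S x := by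
    intro x y z hy hz
    simp only [S, mem_ofPred_eq] at *
    nlinarith [dist_triangle x y z]
  have hclosed : ∀ x, IsClosed (S x) := fun x => by
    have : LowerSemicontinuous fun z => f z + δ * dist x z :=
      hf.add (Continuous.lowerSemicontinuous (by fun_prop))
    exact this.isClosed_preimage (f x)
  have hstep : ∀ (n : ℕ) (x : X), ∃ x' ∈ S x, ∀ z ∈ S x, f x' ≤ f z + 1 / ((n : ℝ) + 1) := by
    intro n x
    have hb : BddBelow (f '' S x) := hbdd.mono (image_subset_range _ _)
    obtain ⟨_, ⟨x', hx', rfl⟩, hlt⟩ :=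
      Real.lt_sInf_add_pos (Set.Nonempty.image f ⟨x, hself x⟩)
        (Nat.one_div_pos_of_nat (α := ℝ) (n := n))
    exact ⟨x', hx', fun z hz => hlt.le.trans (by gcongr; exact csInf_le hb ⟨z, hz, rfl⟩)⟩
  choose g hgS hg using hstep
  let x : ℕ → X := fun n => Nat.rec x₀ (fun n y => g n y) n
  have hmem : ∀ n m, n ≤ m → x m ∈ S (x n) := by
    intro n m h
    induction m, h using Nat.le_induction with
    | base => exact hself _
    | succ m _ ih => exact htrans ih (hgS m (x m))
  have hanti : Antitone (f ∘ x) := fun n m h => by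
    have := hmem n m h
    simp only [S, mem_ofPred_eq] at this
    have := mul_nonneg hδ.le (dist_nonneg (x := x n) (y := x m))
    simp only [Function.comp]; linarith
  have hb : BddBelow (range (f ∘ x)) := hbdd.mono (range_comp_subset_range _ _)
  have hlim := tendsto_atTop_ciInf hanti hb
  set L := ⨅ i, (f ∘ x) i
  have hL : ∀ n, L ≤ f (x n) := fun n => ciInf_le hb n
  have hcauchy : CauchySeq x := by
    refine cauchySeq_of_le_tendsto_0' (fun n => (f (x n) - L) / δ) (fun n m h => ?_) ?_
    · rw [le_div_iff₀ hδ]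
      have := hmem n m h
      simp only [S, mem_ofPred_eq] at this
      linarith [hL m]
    · simpa using (hlim.sub_const L).div_const δ
  obtain ⟨y, hy⟩ := cauchySeq_tendsto_of_complete hcauchy
  have hyS : ∀ n, y ∈ S (x n) := fun n =>
    (hclosed (x n)).mem_of_tendsto hy (eventually_atTop.2 ⟨n, fun m hm => hmem n m hm⟩)
  have hyle : ∀ n, f y ≤ f (x n) := fun n => by
    have := hyS n
    simp only [S, mem_ofPred_eq] at this
    have := mul_nonneg hδ.le (dist_nonneg (x := x n) (y := y))
    linarith
  refine ⟨y, hyle 0, fun z => ?_⟩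
  by_cases hz : z ∈ S y
  · have hle : ∀ n : ℕ, f y ≤ f z + 1 / ((n : ℝ) + 1) := fun n =>
      (hyle (n + 1)).trans (hg n (x n) z (htrans (hyS n) hz))
    have hle' : f y ≤ f z := by
      refine ge_of_tendsto' (x := atTop) ?_ hle
      simpa using (tendsto_one_div_add_atTop_nhds_zero_nat (𝕜 := ℝ)).const_add (f z)
    have := mul_nonneg hδ.le (dist_nonneg (x := y) (y := z))
    linarith
  · simp only [S, mem_ofPred_eq, not_le] at hz
    exact hz.le

theorem HasDerivAt.eventually_pos_right {f : ℝ → ℝ} {f' x : ℝ} (hf : HasDerivAt f f' x)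
    (hx : f x = 0) (hf' : 0 < f') : ∀ᶠ t in nhdsWithin x (Ioi x), 0 < f t := by
  have h := (hasDerivWithinAt_iff_tendsto_slope' self_notMem_Ioi).1
    (hf.hasDerivWithinAt (s := Ioi x))
  filter_upwards [h.eventually_const_lt hf', self_mem_nhdsWithin] with t ht htx
  have htx : 0 < t - x := sub_pos.2 htx
  rw [slope_def_field, hx, sub_zero] at ht
  exact (div_pos_iff_of_pos_right htx).1 ht

theorem HasDerivAt.eventually_neg_right {f : ℝ → ℝ} {f' x : ℝ} (hf : HasDerivAt f f' x)
    (hx : f x = 0) (hf' : f' < 0) : ∀ᶠ t in nhdsWithin x (Ioi x), f t < 0 := by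
  have := hf.neg.eventually_pos_right (by simp [hx]) (neg_pos.2 hf')
  simpa using this

section

variable {H : Type*} [NormedAddCommGroup H] [InnerProductSpace ℝ H]

theorem hasDerivAt_inner_smul_curve {G : H → H} {A : H →L[ℝ] H} {u w' : H} {w : ℝ → H} (c : ℝ)
    (hG : HasFDerivAt G A u) (hw : HasDerivAt w w' 0) (hw0 : w 0 = u) :
    HasDerivAt (fun t => ⟪G ((1 + c * t) • w t), w t⟫)
      (c * ⟪A u, u⟫ + (⟪A w', u⟫ + ⟪G u, w'⟫)) 0 := by
  have h1 : HasDerivAt (fun t : ℝ => 1 + c * t) c 0 := by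
    simpa using ((hasDerivAt_id (0 : ℝ)).const_mul c).const_add 1
  have h2 := hG.comp_hasDerivAt_of_eq (0 : ℝ) (h1.fun_smul hw) (by simp [hw0])
  have h3 := h2.inner ℝ hw
  refine h3.congr_deriv ?_
  simp [hw0, inner_add_left, real_inner_smul_left]
  ring

/-- Derivative of the Nehari scaling `s` along a curve `w` in the cone starting at a point of the
Nehari set. -/
theorem hasDerivWithinAt_nehari_scale {G : H → H} {A : H →L[ℝ] H} {K : Set H} {r R : ℝ} {s : H → ℝ}
    (h1 : ∀ u ∈ K \ {0}, s u ∈ Ioo (r / ‖u‖) (R / ‖u‖) ∧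
      (∀ τ ∈ Ico (r / ‖u‖) (s u), 0 < ⟪G (τ • u), u⟫) ∧
      (∀ τ ∈ Ioc (s u) (R / ‖u‖), ⟪G (τ • u), u⟫ < 0))
    {u w' : H} {w : ℝ → H} (hu : u ∈ K \ {0}) (hsu : s u = 1) (hGu : ⟪G u, u⟫ = 0)
    (hG : HasFDerivAt G A u) (hA : ⟪A u, u⟫ ≠ 0) (hw : HasDerivAt w w' 0) (hw0 : w 0 = u)
    (hwK : ∀ᶠ t in nhdsWithin (0 : ℝ) (Ioi 0), w t ∈ K) :
    HasDerivWithinAt (fun t => s (w t)) (-(⟪A w', u⟫ + ⟪G u, w'⟫) / ⟪A u, u⟫) (Ioi 0) 0 := by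
  obtain ⟨hs, -, hneg⟩ := h1 u hu
  rw [hsu] at hs hneg
  have hA' : ⟪A u, u⟫ < 0 := by
    refine hA.lt_or_gt.resolve_right fun hpos => ?_
    have hd := hasDerivAt_inner_smul_curve 1 hG (hasDerivAt_const (0 : ℝ) u) rfl
    have hev := hd.eventually_pos_right (by simpa using hGu) (by simpa using hpos)
    have hlt : ∀ᶠ t : ℝ in nhdsWithin 0 (Ioi 0), 1 + 1 * t < R / ‖u‖ := by
      refine Tendsto.eventually_lt_const hs.2 (tendsto_nhdsWithin_of_tendsto_nhds ?_)
      exact (Continuous.tendsto' (by fun_prop) _ _ (by simp))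
    obtain ⟨t, ht1, ht2, ht3⟩ := (hev.and (hlt.and self_mem_nhdsWithin)).exists
    have ht3 : 0 < t := ht3
    exact (hneg (1 + 1 * t) ⟨by linarith, ht2.le⟩).not_gt ht1
  have hwne : ∀ᶠ t in nhdsWithin (0 : ℝ) (Ioi 0), w t ∈ K \ {0} := by
    have : ∀ᶠ t in nhds (0 : ℝ), w t ≠ 0 := hw.continuousAt.eventually_ne (by rw [hw0]; exact hu.2)
    filter_upwards [hwK, this.filter_mono nhdsWithin_le_nhds] with t ht1 ht2 using ⟨ht1, ht2⟩
  have hnorm : Tendsto (fun t => ‖w t‖) (nhds 0) (nhds ‖u‖) := by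
    simpa [hw0] using hw.continuousAt.norm.tendsto
  have hune : ‖u‖ ≠ 0 := norm_ne_zero_iff.2 hu.2
  have hlin : ∀ c : ℝ, Tendsto (fun t : ℝ => 1 + c * t) (nhds 0) (nhds 1) := fun c =>
    Continuous.tendsto' (by fun_prop) _ _ (by simp)
  have hlow : ∀ c : ℝ, ∀ᶠ t in nhdsWithin (0 : ℝ) (Ioi 0), r / ‖w t‖ < 1 + c * t := fun c =>
    ((tendsto_const_nhds.div hnorm hune).eventually_lt (hlin c) hs.1).filter_mono nhdsWithin_le_nhds
  have hupp : ∀ c : ℝ, ∀ᶠ t in nhdsWithin (0 : ℝ) (Ioi 0), 1 + c * t < R / ‖w t‖ := fun c =>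
    ((hlin c).eventually_lt (tendsto_const_nhds.div hnorm hune) hs.2).filter_mono nhdsWithin_le_nhds
  rw [hasDerivWithinAt_iff_tendsto_slope' self_notMem_Ioi]
  have hval : ∀ c : ℝ, ⟪G ((1 + c * 0) • w 0), w 0⟫ = 0 := fun c => by simp [hw0, hGu]
  refine tendsto_order.2 ⟨fun b hb => ?_, fun b hb => ?_⟩
  · obtain ⟨c, hbc, hc⟩ := exists_between hb
    rw [lt_div_iff_of_neg hA'] at hc
    have := (hasDerivAt_inner_smul_curve c hG hw hw0).eventually_pos_right (hval c) (by linarith)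
    filter_upwards [this, hwne, hupp c, self_mem_nhdsWithin] with t hpos hK hR ht
    refine hbc.trans_le ?_
    rw [slope_def_field, hw0, hsu, sub_zero, le_div_iff₀ ht]
    by_contra! hlt
    exact ((h1 _ hK).2.2 _ ⟨by linarith, hR.le⟩).not_gt hpos
  · obtain ⟨c, hc, hcb⟩ := exists_between hb
    rw [div_lt_iff_of_neg hA'] at hc
    have := (hasDerivAt_inner_smul_curve c hG hw hw0).eventually_neg_right (hval c) (by linarith)
    filter_upwards [this, hwne, hlow c, self_mem_nhdsWithin] with t hneg hK hr ht
    refine lt_of_le_of_lt ?_ hcb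
    rw [slope_def_field, hw0, hsu, sub_zero, div_le_iff₀ ht]
    by_contra! hlt
    exact ((h1 _ hK).2.1 _ ⟨hr.le, by linarith⟩).not_gt hneg

/-- A function that decreases at rate at most `δ` along a curve has right derivative at least
`-δ` times the speed of the curve. -/
theorem neg_mul_norm_le_of_hasDerivWithinAt {F : Type*} [NormedAddCommGroup F] [NormedSpace ℝ F]
    {E : F → ℝ} {γ : ℝ → F} {γ' : F} {e' x δ : ℝ} (hγ : HasDerivWithinAt γ γ' (Ioi x) x)
    (hE : HasDerivWithinAt (E ∘ γ) e' (Ioi x) x)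
    (h : ∀ᶠ t in nhdsWithin x (Ioi x), E (γ x) ≤ E (γ t) + δ * dist (γ x) (γ t)) :
    -(δ * ‖γ'‖) ≤ e' := by
  rw [hasDerivWithinAt_iff_tendsto_slope' self_notMem_Ioi] at hγ hE
  refine le_of_tendsto_of_tendsto (hγ.norm.const_mul δ).neg hE ?_
  filter_upwards [h, self_mem_nhdsWithin] with t ht htx
  have htx : 0 < t - x := sub_pos.2 htx
  rw [slope_def_field, le_div_iff₀ htx, slope_def_module, norm_smul, norm_inv, Real.norm_eq_abs,
    abs_of_pos htx]
  rw [dist_comm, dist_eq_norm] at ht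
  have : -(δ * ((t - x)⁻¹ * ‖γ t - γ x‖)) * (t - x) = -(δ * ‖γ t - γ x‖) := by
    field_simp
  rw [this]
  simp only [Function.comp]
  linarith

/-- If `G` changes sign along each ray as in the Nehari condition, then the scaled point
satisfies the Nehari equation, and its own scaling is `1`. -/
theorem nehari_scale_smul {G : H → H} (hGc : Continuous G) {K : Set H}
    (hKsmul : ∀ c : ℝ, 0 ≤ c → ∀ u ∈ K, c • u ∈ K) {r R : ℝ} (hr : 0 < r) {s : H → ℝ}
    (h1 : ∀ u ∈ K \ {0}, s u ∈ Ioo (r / ‖u‖) (R / ‖u‖) ∧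
      (∀ τ ∈ Ico (r / ‖u‖) (s u), 0 < ⟪G (τ • u), u⟫) ∧
      (∀ τ ∈ Ioc (s u) (R / ‖u‖), ⟪G (τ • u), u⟫ < 0))
    {v : H} (hv : v ∈ K \ {0}) :
    s v • v ∈ K \ {0} ∧ s (s v • v) = 1 ∧ ⟪G (s v • v), s v • v⟫ = 0 ∧ ‖s v • v‖ < R := by
  obtain ⟨hs, hpos, hneg⟩ := h1 v hv
  have hvn : 0 < ‖v‖ := norm_pos_iff.2 hv.2
  have hs0 : 0 < s v := (div_pos hr hvn).trans hs.1
  have hnorm : ‖s v • v‖ = s v * ‖v‖ := by rw [norm_smul, Real.norm_eq_abs, abs_of_pos hs0]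
  have hcont : Continuous fun τ : ℝ => ⟪G (τ • v), v⟫ := by fun_prop
  have hzero : ⟪G (s v • v), v⟫ = 0 := by
    refine le_antisymm ?_ ?_
    · refine le_of_tendsto (hcont.continuousWithinAt (s := Ioi (s v)) (x := s v)) ?_
      filter_upwards [Ioc_mem_nhdsGT hs.2] with τ hτ using (hneg τ hτ).le
    · refine ge_of_tendsto (hcont.continuousWithinAt (s := Iio (s v)) (x := s v)) ?_
      filter_upwards [Ico_mem_nhdsLT hs.1] with τ hτ using (hpos τ hτ).le
  have hu : s v • v ∈ K \ {0} := ⟨hKsmul _ hs0.le _ hv.1, smul_ne_zero hs0.ne' hv.2⟩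
  have hGu : ⟪G (s v • v), s v • v⟫ = 0 := by rw [real_inner_smul_right, hzero, mul_zero]
  have hlt : r < ‖s v • v‖ := by rw [hnorm]; exact (div_lt_iff₀ hvn).1 hs.1
  have hgt : ‖s v • v‖ < R := by rw [hnorm]; exact (lt_div_iff₀ hvn).1 hs.2
  refine ⟨hu, ?_, hGu, hgt⟩
  obtain ⟨-, hpos', hneg'⟩ := h1 _ hu
  have hun : 0 < ‖s v • v‖ := hr.trans hlt
  rcases lt_trichotomy (s (s v • v)) 1 with h | h | h
  · have := hneg' 1 ⟨h, (one_le_div hun).2 hgt.le⟩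
    rw [one_smul, hGu] at this
    exact absurd this (lt_irrefl _)
  · exact h
  · have := hpos' 1 ⟨(div_le_one hun).2 hlt.le, h⟩
    rw [one_smul, hGu] at this
    exact absurd this (lt_irrefl _)

theorem abs_bilin_le_of_unit {A : H →L[ℝ] H} {C : ℝ}
    (h : ∀ z y : H, ‖z‖ = 1 → ‖y‖ = 1 → |⟪A y, z⟫| ≤ C) (z y : H) :
    |⟪A y, z⟫| ≤ C * ‖y‖ * ‖z‖ := by
  rcases eq_or_ne z 0 with rfl | hz
  · simp
  rcases eq_or_ne y 0 with rfl | hy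
  · simp
  have hz' := norm_pos_iff.2 hz
  have hy' := norm_pos_iff.2 hy
  have := h (‖z‖⁻¹ • z) (‖y‖⁻¹ • y) (norm_smul_inv_norm (𝕜 := ℝ) hz)
    (norm_smul_inv_norm (𝕜 := ℝ) hy)
  rw [map_smul, real_inner_smul_left, real_inner_smul_right, abs_mul, abs_mul, abs_inv, abs_inv,
    abs_norm, abs_norm, inv_mul_le_iff₀ hy', inv_mul_le_iff₀ hz'] at this
  linarith

/-- Gradient bound at an almost-minimizer, in Ekeland's sense, of `E` on the Nehari set. -/
theorem norm_gradient_le_of_nehari_almost_min [CompleteSpace H] {E : H → ℝ} {G : H → H}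
    {A : H →L[ℝ] H} {K : Set H} (hKsmul : ∀ c : ℝ, 0 ≤ c → ∀ u ∈ K, c • u ∈ K)
    (hKadd : ∀ u ∈ K, ∀ v ∈ K, u + v ∈ K) {r R : ℝ} {s : H → ℝ}
    (h1 : ∀ u ∈ K \ {0}, s u ∈ Ioo (r / ‖u‖) (R / ‖u‖) ∧
      (∀ τ ∈ Ico (r / ‖u‖) (s u), 0 < ⟪G (τ • u), u⟫) ∧
      (∀ τ ∈ Ioc (s u) (R / ‖u‖), ⟪G (τ • u), u⟫ < 0))
    {u : H} (hu : u ∈ K \ {0}) (hNu : u - G u ∈ K) (hsu : s u = 1) (hGu : ⟪G u, u⟫ = 0)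
    (huR : ‖u‖ < R) (hE : HasGradientAt E (G u) u) (hG : HasFDerivAt G A u)
    {C₁ C₂ δ : ℝ} (hC₁ : 0 < C₁) (hC₂ : 0 < C₂) (hδ : 0 < δ)
    (hA₁ : |⟪A (G u), u⟫| ≤ C₁ * ‖G u‖ * ‖u‖) (hA₂ : C₂ ≤ |⟪A u, u⟫|)
    (hmin : ∀ v ∈ K \ {0}, E u ≤ E (s v • v) + δ * dist u (s v • v)) :
    ‖G u‖ ≤ δ * (1 + R * (C₁ * R) / C₂ + R / C₂ * ‖G u‖) := by
  have hA : ⟪A u, u⟫ ≠ 0 := abs_pos.1 (hC₂.trans_le hA₂)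
  let w : ℝ → H := fun t => u - t • G u
  have hw0 : w 0 = u := by simp [w]
  have hw : HasDerivAt w (-G u) 0 := by
    simpa using ((hasDerivAt_id (0 : ℝ)).smul_const (G u)).const_sub u
  have hwK : ∀ᶠ t in nhdsWithin (0 : ℝ) (Ioi 0), w t ∈ K := by
    filter_upwards [Ioc_mem_nhdsGT (zero_lt_one' ℝ)] with t ht
    have : w t = (1 - t) • u + t • (u - G u) := by simp only [w]; module
    rw [this]
    exact hKadd _ (hKsmul _ (by linarith [ht.2]) _ hu.1) _ (hKsmul _ ht.1.le _ hNu)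
  have hwne : ∀ᶠ t in nhdsWithin (0 : ℝ) (Ioi 0), w t ∈ K \ {0} := by
    have : ∀ᶠ t in nhds (0 : ℝ), w t ≠ 0 := hw.continuousAt.eventually_ne (by rw [hw0]; exact hu.2)
    filter_upwards [hwK, this.filter_mono nhdsWithin_le_nhds] with t ht1 ht2 using ⟨ht1, ht2⟩
  have hs := hasDerivWithinAt_nehari_scale h1 hu hsu hGu hG hA hw hw0 hwK
  set σ := -(⟪A (-G u), u⟫ + ⟪G u, -G u⟫) / ⟪A u, u⟫ with hσ
  have hγ := hs.fun_smul hw.hasDerivWithinAt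
  simp only [hw0, hsu, one_smul] at hγ
  have hEγ := hE.hasFDerivAt.comp_hasDerivWithinAt_of_eq (0 : ℝ) hγ (by simp [hw0, hsu])
  have key := neg_mul_norm_le_of_hasDerivWithinAt (δ := δ) hγ hEγ <| by
    filter_upwards [hwne] with t ht
    simpa [hw0, hsu] using hmin _ ht
  simp only [InnerProductSpace.toDual_apply_apply, inner_add_right, inner_neg_right,
    real_inner_smul_right, hGu, real_inner_self_eq_norm_sq] at key
  have hR : 0 < R := (norm_nonneg u).trans_lt huR
  have hσle : |σ| ≤ (C₁ * ‖G u‖ * R + ‖G u‖ ^ 2) / C₂ := by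
    rw [hσ, abs_div]
    refine div_le_div₀ (by positivity) ?_ hC₂ hA₂
    rw [map_neg, inner_neg_left, inner_neg_right, real_inner_self_eq_norm_sq, abs_neg, ← neg_add,
      abs_neg]
    refine (abs_add_le _ _).trans (add_le_add (hA₁.trans (by gcongr)) ?_)
    rw [abs_of_nonneg (sq_nonneg _)]
  have hnorm : ‖-G u + σ • u‖ ≤ ‖G u‖ + (C₁ * ‖G u‖ * R + ‖G u‖ ^ 2) / C₂ * R := by
    refine (norm_add_le _ _).trans ?_
    rw [norm_neg, norm_smul, Real.norm_eq_abs]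
    gcongr
  have hsq : ‖G u‖ ^ 2 ≤ δ * (‖G u‖ + (C₁ * ‖G u‖ * R + ‖G u‖ ^ 2) / C₂ * R) := by
    have := mul_le_mul_of_nonneg_left hnorm hδ.le
    linarith
  rcases (norm_nonneg (G u)).eq_or_lt with h0 | hpos
  · rw [← h0]; positivity
  · refine le_of_mul_le_mul_left ?_ hpos
    calc ‖G u‖ * ‖G u‖ = ‖G u‖ ^ 2 := by ring
      _ ≤ _ := hsq
      _ = _ := by ring

end

/-- Localization of a minimizing/Palais-Smale sequence on the
Nehari-type set `𝒩 = { s(u) • u : u ∈ K \ {0} }`. -/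
theorem nehari_minimizing_sequence
    {H : Type*} [NormedAddCommGroup H] [InnerProductSpace ℝ H] [CompleteSpace H]
    (E : H → ℝ) (E' : H → H) (E'' : H → H → H → ℝ)
    -- E is twice continuously Fréchet differentiable, with gradient E'
    (hE : ContDiff ℝ 2 E)
    (hgrad : ∀ u, HasGradientAt E (E' u) u)
    -- E'' is the second derivative of E, in the sense of the paper
    (hE'' : ∀ u z y, Tendsto (fun t : ℝ => (1 / t) * ⟪E' (u + t • y) - E' u, z⟫)
      (nhdsWithin 0 (Ioi 0)) (nhds (E'' u z y)))
    -- K is a closed nondegenerate cone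
    (K : Set H) (hKne : (K \ {0}).Nonempty) (hKclosed : IsClosed K)
    (hKsmul : ∀ c : ℝ, 0 ≤ c → ∀ u ∈ K, c • u ∈ K)
    (hKadd : ∀ u ∈ K, ∀ v ∈ K, u + v ∈ K)
    -- invariance of the cone under N(u) = u - E'(u)
    (hN : ∀ u ∈ K, u - E' u ∈ K)
    (r R : ℝ) (hr : 0 < r) (hrR : r < R)
    -- condition (h1)
    (s : H → ℝ)
    (h1 : ∀ u ∈ K \ {0}, s u ∈ Ioo (r / ‖u‖) (R / ‖u‖) ∧
      (∀ τ ∈ Ico (r / ‖u‖) (s u), 0 < ⟪E' (τ • u), u⟫) ∧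
      (∀ τ ∈ Ioc (s u) (R / ‖u‖), ⟪E' (τ • u), u⟫ < 0))
    -- the Nehari set 𝒩, assumed closed
    (𝒩 : Set H) (h𝒩 : 𝒩 = {w | ∃ u ∈ K \ {0}, w = s u • u})
    (h𝒩closed : IsClosed 𝒩)
    -- (h2): E is bounded from below on 𝒩
    (h2 : BddBelow (E '' 𝒩))
    -- (h3): uniform bound on the second derivative on 𝒩
    (C₁ : ℝ) (hC₁ : 0 < C₁)
    (h3 : ∀ u ∈ 𝒩, ∀ w₁ w₂ : H, ‖w₁‖ = 1 → ‖w₂‖ = 1 → |E'' u w₁ w₂| ≤ C₁)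
    -- (h4): nondegeneracy of the second derivative along the radial direction
    (C₂ : ℝ) (hC₂ : 0 < C₂)
    (h4 : ∀ u ∈ 𝒩, C₂ ≤ |E'' u u u|) :
    ∃ u : ℕ → H, (∀ n, u n ∈ 𝒩) ∧
      Tendsto (fun n => E (u n)) atTop (nhds (sInf (E '' 𝒩))) ∧
      Tendsto (fun n => ‖E' (u n)‖) atTop (nhds 0) := by
  have hCD : ContDiff ℝ 1 E' := by
    have : E' = fun u => (InnerProductSpace.toDual ℝ H).symm (fderiv ℝ E u) := by
      ext1 u
      rw [(hgrad u).hasFDerivAt.fderiv, LinearIsometryEquiv.symm_apply_apply]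
    rw [this]
    exact (InnerProductSpace.toDual ℝ H).symm.contDiff.comp (hE.fderiv_right (by norm_num))
  have hdiff : ∀ u, HasFDerivAt E' (fderiv ℝ E' u) u := fun u =>
    (hCD.differentiable one_ne_zero u).hasFDerivAt
  have hE''eq : ∀ u z y, E'' u z y = ⟪fderiv ℝ E' u y, z⟫ := by
    intro u z y
    have hl := ((hdiff u).hasLineDerivAt y).tendsto_slope_zero_right.inner (𝕜 := ℝ)
      (tendsto_const_nhds (x := z))
    refine tendsto_nhds_unique (hE'' u z y) (hl.congr fun t => ?_)
    rw [real_inner_smul_left, one_div]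
  have hmem : ∀ v ∈ K \ {0}, s v • v ∈ 𝒩 := fun v hv => h𝒩 ▸ ⟨v, hv, rfl⟩
  have hprop : ∀ u ∈ 𝒩, u ∈ K \ {0} ∧ s u = 1 ∧ ⟪E' u, u⟫ = 0 ∧ ‖u‖ < R := by
    intro u hu
    rw [h𝒩] at hu
    obtain ⟨v, hv, rfl⟩ := hu
    exact nehari_scale_smul hCD.continuous hKsmul hr h1 hv
  obtain ⟨v₀, hv₀⟩ := hKne
  have hne : (E '' 𝒩).Nonempty := ⟨_, _, hmem v₀ hv₀, rfl⟩
  have hR : 0 < R := hr.trans hrR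
  have hδ : ∀ n : ℕ, 0 < 1 / ((n : ℝ) + 1) := fun n => Nat.one_div_pos_of_nat
  have hex : ∀ n : ℕ, ∃ u ∈ 𝒩, E u ≤ sInf (E '' 𝒩) + 1 / ((n : ℝ) + 1) ∧
      ‖E' u‖ ≤ 1 / ((n : ℝ) + 1) * (1 + R * (C₁ * R) / C₂ + R / C₂ * ‖E' u‖) := by
    intro n
    obtain ⟨_, ⟨x, hx, rfl⟩, hxlt⟩ := Real.lt_sInf_add_pos hne (hδ n)
    have : CompleteSpace 𝒩 := h𝒩closed.completeSpace_coe
    have hlsc : LowerSemicontinuous fun u : 𝒩 => E u :=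
      (hE.continuous.comp continuous_subtype_val).lowerSemicontinuous
    obtain ⟨⟨u, hu⟩, hux, hmin⟩ := hlsc.exists_le_add_mul_dist
      (h2.mono (by rintro _ ⟨v, rfl⟩; exact ⟨v, v.2, rfl⟩)) (hδ n) ⟨x, hx⟩
    refine ⟨u, hu, hux.trans hxlt.le, ?_⟩
    obtain ⟨huK, hsu, hGu, huR⟩ := hprop u hu
    refine norm_gradient_le_of_nehari_almost_min hKsmul hKadd h1 huK (hN u huK.1) hsu hGu huR
      (hgrad u) (hdiff u) hC₁ hC₂ (hδ n) (abs_bilin_le_of_unit (fun z y hz hy => ?_) _ _) ?_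
      fun v hv => hmin ⟨_, hmem v hv⟩
    · rw [← hE''eq]
      exact h3 u hu z y hz hy
    · rw [← hE''eq]
      exact h4 u hu
  choose u hu hEu hgu using hex
  have hlim := tendsto_one_div_add_atTop_nhds_zero_nat (𝕜 := ℝ)
  refine ⟨u, hu, ?_, ?_⟩
  · refine tendsto_of_tendsto_of_tendsto_of_le_of_le tendsto_const_nhds
      (by simpa using hlim.const_add (sInf (E '' 𝒩)))
      (fun n => csInf_le h2 ⟨u n, hu n, rfl⟩) hEu
  · have hsmall : ∀ᶠ n : ℕ in atTop, 1 / ((n : ℝ) + 1) * (R / C₂) < 1 / 2 :=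
      Tendsto.eventually_lt_const (by norm_num) (hlim.mul_const (R / C₂))
    refine squeeze_zero' (Eventually.of_forall fun n => norm_nonneg _)
      (g := fun n : ℕ => 1 / ((n : ℝ) + 1) * (2 * (1 + R * (C₁ * R) / C₂))) ?_
      (by simpa using hlim.mul_const (2 * (1 + R * (C₁ * R) / C₂)))
    filter_upwards [hsmall] with n hn
    have := mul_le_mul_of_nonneg_right hn.le (norm_nonneg (E' (u n)))
    linarith [hgu n]
end

section
/- Assume (H1): Ã > 0, C̃ > 0, f(r)/r < π/Ã, and f(Rφ(β))/R > 1/(2φ(β)C̃); and assume (H2): there exists a continuous function θ : [0,R] → ℝ with θ(t) > 0 for t ∈ (0,R] such that t f'(t) − f(t) ≥ θ(t) for all t ∈ [0,R]. Then there exists u* ∈ K with r < ‖u*‖ < R satisfying u*(t) = ∫₀¹ G(t,s) f(u*(s)) g(s) ds for all t ∈ [0,1]; that is, u* is a positive symmetric solution of the Dirichlet problem −u'' = g f(u) on [0,1], u(0) = u(1) = 0, localized in the annular conical set { u ∈ K : r < ‖u‖ < R }. -/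
open Set

/-- `φ(t) = t(1-2t)`. -/
noncomputable def phi (t : ℝ) : ℝ := t * (1 - 2 * t)

/-- The `H¹₀` (energetic) norm `‖u‖ = (∫₀¹ u'(t)² dt)^{1/2}`. -/
noncomputable def normH (u : ℝ → ℝ) : ℝ := Real.sqrt (∫ t in (0:ℝ)..1, deriv u t ^ 2)

/-- Membership in the cone `K`: continuously differentiable on `[0,1]`, vanishing at the
endpoints, symmetric about `1/2`, nondecreasing on `[0,1/2]`, and satisfying the Harnack
inequality `u(t) ≥ φ(t)‖u‖` on `[0,1/2]`. -/
def memK (u : ℝ → ℝ) : Prop :=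
  (∀ t ∈ Icc (0:ℝ) 1, DifferentiableAt ℝ u t) ∧
  ContinuousOn (deriv u) (Icc (0:ℝ) 1) ∧
  u 0 = 0 ∧ u 1 = 0 ∧
  (∀ t ∈ Icc (0:ℝ) 1, u t = u (1 - t)) ∧
  MonotoneOn u (Icc (0:ℝ) (1/2)) ∧
  (∀ t ∈ Icc (0:ℝ) (1/2), phi t * normH u ≤ u t)

/-- Green's function of `-u''` with Dirichlet boundary conditions on `[0,1]`. -/
noncomputable def G (t s : ℝ) : ℝ := if s ≤ t then s * (1 - t) else t * (1 - s)

open MeasureTheory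

/-- The primitive `t ↦ ∫ₜ^{1/2} P` of `-P` vanishing at `1/2`. -/
noncomputable def backSlope (P : ℝ → ℝ) (t : ℝ) : ℝ := ∫ s in t..(1/2:ℝ), P s

/-- The function vanishing at `0` whose derivative is `backSlope P`. -/
noncomputable def dirichletSol (P : ℝ → ℝ) (t : ℝ) : ℝ := ∫ y in (0:ℝ)..t, backSlope P y

section Primitive

variable {P : ℝ → ℝ}

lemma backSlope_sub (hP : ∀ a b, IntervalIntegrable P volume a b) (a b : ℝ) :
    backSlope P a - backSlope P b = ∫ s in a..b, P s :=
  intervalIntegral.integral_interval_sub_interval_comm (hP _ _) (hP _ _) (hP _ _) |>.trans <| by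
    simp

lemma continuous_backSlope (hP : ∀ a b, IntervalIntegrable P volume a b) :
    Continuous (backSlope P) := by
  have h := (intervalIntegral.continuous_primitive hP (1/2)).neg
  refine h.congr fun t => ?_
  rw [backSlope, intervalIntegral.integral_symm (1/2) t]
  rfl

lemma antitone_backSlope (hP : ∀ a b, IntervalIntegrable P volume a b) (h0 : ∀ s, 0 ≤ P s) :
    Antitone (backSlope P) := by
  intro a b hab
  have h := backSlope_sub hP a b
  have h' : 0 ≤ ∫ s in a..b, P s := intervalIntegral.integral_nonneg hab fun s _ => h0 s
  linarith

lemma backSlope_half : backSlope P (1/2) = 0 := by simp [backSlope]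

lemma backSlope_one_sub (hs : ∀ s, P (1 - s) = P s) (t : ℝ) :
    backSlope P (1 - t) = -backSlope P t := by
  have h := intervalIntegral.integral_comp_sub_left (a := t) (b := 1/2) P 1
  simp only [hs] at h
  rw [backSlope, backSlope, h, intervalIntegral.integral_symm]
  norm_num

lemma hasDerivAt_dirichletSol (hP : ∀ a b, IntervalIntegrable P volume a b) (t : ℝ) :
    HasDerivAt (dirichletSol P) (backSlope P t) t :=
  (continuous_backSlope hP).integral_hasStrictDerivAt 0 t |>.hasDerivAt

lemma dirichletSol_sub (hP : ∀ a b, IntervalIntegrable P volume a b) (a b : ℝ) :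
    dirichletSol P b - dirichletSol P a = ∫ y in a..b, backSlope P y :=
  intervalIntegral.integral_interval_sub_left
    ((continuous_backSlope hP).intervalIntegrable _ _)
    ((continuous_backSlope hP).intervalIntegrable _ _)

lemma dirichletSol_zero : dirichletSol P 0 = 0 := by simp [dirichletSol]

lemma dirichletSol_one_sub (hP : ∀ a b, IntervalIntegrable P volume a b)
    (hs : ∀ s, P (1 - s) = P s) (t : ℝ) : dirichletSol P (1 - t) = dirichletSol P t := by
  have h := intervalIntegral.integral_comp_sub_left (a := t) (b := 1 - t) (backSlope P) 1
  simp only [backSlope_one_sub hs, intervalIntegral.integral_neg, sub_sub_cancel] at h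
  have h' := dirichletSol_sub hP t (1 - t)
  linarith

lemma dirichletSol_one (hP : ∀ a b, IntervalIntegrable P volume a b)
    (hs : ∀ s, P (1 - s) = P s) : dirichletSol P 1 = 0 := by
  have h := dirichletSol_one_sub hP hs 0
  rwa [sub_zero, dirichletSol_zero] at h

/-- Lower and upper bounds for increments by the slope at the endpoints (concavity). -/
lemma mul_backSlope_le_dirichletSol_sub (hP : ∀ a b, IntervalIntegrable P volume a b)
    (h0 : ∀ s, 0 ≤ P s) {a b : ℝ} (hab : a ≤ b) :
    (b - a) * backSlope P b ≤ dirichletSol P b - dirichletSol P a := by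
  rw [dirichletSol_sub hP]
  have h := intervalIntegral.integral_mono_on (μ := volume) hab (f := fun _ => backSlope P b)
    (g := backSlope P) intervalIntegrable_const ((continuous_backSlope hP).intervalIntegrable _ _)
    fun x hx => antitone_backSlope hP h0 hx.2
  simpa using h

lemma dirichletSol_sub_le_mul_backSlope (hP : ∀ a b, IntervalIntegrable P volume a b)
    (h0 : ∀ s, 0 ≤ P s) {a b : ℝ} (hab : a ≤ b) :
    dirichletSol P b - dirichletSol P a ≤ (b - a) * backSlope P a := by
  rw [dirichletSol_sub hP]
  have h := intervalIntegral.integral_mono_on (μ := volume) hab (g := fun _ => backSlope P a)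
    (f := backSlope P) ((continuous_backSlope hP).intervalIntegrable _ _) intervalIntegrable_const
    fun x hx => antitone_backSlope hP h0 hx.1
  simpa using h

lemma backSlope_nonneg (hP : ∀ a b, IntervalIntegrable P volume a b)
    (h0 : ∀ s, 0 ≤ P s) {t : ℝ} (ht : t ≤ 1/2) : 0 ≤ backSlope P t := by
  rw [← backSlope_half (P := P)]
  exact antitone_backSlope hP h0 ht

lemma monotoneOn_dirichletSol (hP : ∀ a b, IntervalIntegrable P volume a b)
    (h0 : ∀ s, 0 ≤ P s) : MonotoneOn (dirichletSol P) (Iic (1/2)) := by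
  intro a _ b hb hab
  have h := mul_backSlope_le_dirichletSol_sub hP h0 hab
  have h' := mul_nonneg (sub_nonneg.2 hab) (backSlope_nonneg hP h0 hb)
  linarith

lemma dirichletSol_eq_mul_add_integral (hP : ∀ a b, IntervalIntegrable P volume a b) (t : ℝ) :
    dirichletSol P t = t * backSlope P t + ∫ s in (0:ℝ)..t, s * P s := by
  have hac := (hP 0 t).absolutelyContinuousOnInterval_intervalIntegral
    (c := 0) (by simp)
  have hid : AbsolutelyContinuousOnInterval (fun x : ℝ => x) 0 t := by
    have h := (intervalIntegrable_const (μ := volume) (a := 0) (b := t)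
      (c := (1:ℝ))).absolutelyContinuousOnInterval_intervalIntegral (c := 0) (by simp)
    simpa using h
  have h := hid.integral_mul_deriv_eq_deriv_mul hac
  have hd : ∫ x in (0:ℝ)..t, x * deriv (fun x => ∫ v in (0:ℝ)..x, P v) x
      = ∫ s in (0:ℝ)..t, s * P s := by
    refine intervalIntegral.integral_congr_ae ?_
    filter_upwards [(hP 0 t).ae_hasDerivAt_integral] with x hx hx'
    rw [(hx (uIoc_subset_uIcc hx') 0 (by simp)).deriv]
  have hb : ∀ y, ∫ v in (0:ℝ)..y, P v = backSlope P 0 - backSlope P y := fun y =>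
    (backSlope_sub hP 0 y).symm
  rw [hd] at h
  simp only [hb, deriv_id'', one_mul] at h
  rw [intervalIntegral.integral_sub intervalIntegrable_const
    ((continuous_backSlope hP).intervalIntegrable _ _)] at h
  simp only [intervalIntegral.integral_const, smul_eq_mul] at h
  rw [h, dirichletSol]
  ring

/-- Green's representation of `dirichletSol P`. -/
lemma dirichletSol_eq_integral_G (hP : ∀ a b, IntervalIntegrable P volume a b)
    (hs : ∀ s, P (1 - s) = P s) {t : ℝ} (ht : t ∈ Icc (0:ℝ) 1) :
    dirichletSol P t = ∫ s in (0:ℝ)..1, G t s * P s := by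
  have hi : ∀ a b, IntervalIntegrable (fun s => s * P s) volume a b := fun a b =>
    (hP a b).continuousOn_mul continuousOn_id
  have hi2 : ∀ a b, IntervalIntegrable (fun s => (1 - s) * P s) volume a b := fun a b =>
    (hP a b).continuousOn_mul (by fun_prop)
  have e1 : EqOn (fun s => (1 - t) * (s * P s)) (fun s => G t s * P s) (uIoc 0 t) := by
    intro s hs
    rw [uIoc_of_le ht.1] at hs
    simp only [G, if_pos hs.2]
    ring
  have e2 : EqOn (fun s => t * ((1 - s) * P s)) (fun s => G t s * P s) (uIoc t 1) := by
    intro s hs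
    rw [uIoc_of_le ht.2] at hs
    simp only [G, if_neg (not_le.2 hs.1)]
    ring
  have h1 := intervalIntegral.integral_congr_ae (μ := volume) (.of_forall fun s h => e1 h)
  have h2 := intervalIntegral.integral_congr_ae (μ := volume) (.of_forall fun s h => e2 h)
  have i1 := ((hi 0 t).const_mul (1 - t)).congr e1
  have i2 := ((hi2 t 1).const_mul t).congr e2
  rw [← intervalIntegral.integral_add_adjacent_intervals i1 i2, ← h1, ← h2]
  simp only [intervalIntegral.integral_const_mul]
  have h3 : ∫ s in t..1, (1 - s) * P s = (∫ s in t..1, P s) - ∫ s in t..1, s * P s := by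
    rw [← intervalIntegral.integral_sub (hP _ _) (hi _ _)]
    simp only [sub_mul, one_mul]
  have h4 := intervalIntegral.integral_add_adjacent_intervals (hi 0 t) (hi t 1)
  have h5 := dirichletSol_eq_mul_add_integral hP 1
  rw [dirichletSol_one hP hs] at h5
  rw [h3, ← backSlope_sub hP, dirichletSol_eq_mul_add_integral hP t]
  linear_combination t * h4 - t * h5

lemma abs_backSlope_le (hP : ∀ a b, IntervalIntegrable P volume a b) (h0 : ∀ s, 0 ≤ P s)
    (hs : ∀ s, P (1 - s) = P s) {t : ℝ} (ht : t ∈ Icc (0:ℝ) 1) :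
    |backSlope P t| ≤ backSlope P 0 := by
  have h := backSlope_one_sub hs 0
  rw [sub_zero] at h
  rw [abs_le, ← h]
  exact ⟨antitone_backSlope hP h0 ht.2, antitone_backSlope hP h0 ht.1⟩

lemma normH_dirichletSol (hP : ∀ a b, IntervalIntegrable P volume a b) :
    normH (dirichletSol P) = Real.sqrt (∫ t in (0:ℝ)..1, backSlope P t ^ 2) := by
  simp only [normH, (hasDerivAt_dirichletSol hP _).deriv]

lemma normH_dirichletSol_le (hP : ∀ a b, IntervalIntegrable P volume a b) (h0 : ∀ s, 0 ≤ P s)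
    (hs : ∀ s, P (1 - s) = P s) : normH (dirichletSol P) ≤ backSlope P 0 := by
  rw [normH_dirichletSol hP]
  refine Real.sqrt_le_iff.2 ⟨backSlope_nonneg hP h0 (by norm_num), ?_⟩
  have h := intervalIntegral.integral_mono_on (μ := volume) zero_le_one (g := fun _ => backSlope P 0 ^ 2)
    (f := fun t => backSlope P t ^ 2)
    (((continuous_backSlope hP).pow 2).intervalIntegrable _ _) intervalIntegrable_const
    fun x hx => sq_le_sq' (abs_le.1 (abs_backSlope_le hP h0 hs hx)).1
      (abs_le.1 (abs_backSlope_le hP h0 hs hx)).2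
  simpa using h

/-- The value at `1/2` is controlled by the energy norm. -/
lemma dirichletSol_half_le_normH (hP : ∀ a b, IntervalIntegrable P volume a b) :
    dirichletSol P (1/2) ≤ normH (dirichletSol P) := by
  rw [normH_dirichletSol hP]
  refine Real.le_sqrt_of_sq_le ?_
  have hc := continuous_backSlope hP
  set a := dirichletSol P (1/2) with ha
  have i1 : ∀ b c, IntervalIntegrable (fun t => backSlope P t ^ 2) volume b c := fun b c =>
    (hc.pow 2).intervalIntegrable _ _
  have i2 : ∀ b c, IntervalIntegrable (fun t => 2 * a * backSlope P t) volume b c := fun b c =>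
    (hc.const_mul (2 * a)).intervalIntegrable _ _
  have h1 : ∫ t in (0:ℝ)..(1/2), (2 * a * backSlope P t - a ^ 2)
      ≤ ∫ t in (0:ℝ)..(1/2), backSlope P t ^ 2 :=
    intervalIntegral.integral_mono_on (μ := volume) (by norm_num) ((i2 _ _).sub intervalIntegrable_const) (i1 _ _)
      fun x _ => by nlinarith [sq_nonneg (backSlope P x - a)]
  rw [intervalIntegral.integral_sub (i2 _ _) intervalIntegrable_const, intervalIntegral.integral_const_mul] at h1
  have h2 : 0 ≤ ∫ t in (1/2:ℝ)..1, backSlope P t ^ 2 :=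
    intervalIntegral.integral_nonneg (by norm_num) fun _ _ => sq_nonneg _
  have h3 := intervalIntegral.integral_add_adjacent_intervals (i1 0 (1/2)) (i1 (1/2) 1)
  have h4 : ∫ t in (0:ℝ)..(1/2), backSlope P t = a := rfl
  rw [h4] at h1
  simp only [intervalIntegral.integral_const, smul_eq_mul] at h1
  nlinarith [sq_nonneg a]

lemma mul_backSlope_zero_le (hP : ∀ a b, IntervalIntegrable P volume a b)
    (hmono : MonotoneOn P (Icc 0 (1/2))) {t : ℝ} (ht : t ∈ Icc (0:ℝ) (1/2)) :
    (1 - 2 * t) * backSlope P 0 ≤ backSlope P t := by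
  have h1 := intervalIntegral.integral_mono_on ht.1 (g := fun _ => P t) (hP 0 t) intervalIntegrable_const
    fun x hx => hmono ⟨hx.1, hx.2.trans ht.2⟩ ht hx.2
  have h2 := intervalIntegral.integral_mono_on ht.2 (f := fun _ => P t) intervalIntegrable_const (hP t (1/2))
    fun x hx => hmono ht ⟨ht.1.trans hx.1, hx.2⟩ hx.1
  rw [← backSlope_sub hP] at h1
  change _ ≤ backSlope P t at h2
  simp only [intervalIntegral.integral_const, smul_eq_mul, sub_zero] at h1 h2
  nlinarith [mul_le_mul_of_nonneg_left h1 (by linarith [ht.2] : 0 ≤ 1 - 2 * t),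
    mul_le_mul_of_nonneg_left h2 (by linarith [ht.1] : 0 ≤ 2 * t)]

lemma memK_dirichletSol (hP : ∀ a b, IntervalIntegrable P volume a b) (h0 : ∀ s, 0 ≤ P s)
    (hs : ∀ s, P (1 - s) = P s) (hmono : MonotoneOn P (Icc 0 (1/2))) :
    memK (dirichletSol P) := by
  refine ⟨fun t _ => (hasDerivAt_dirichletSol hP t).differentiableAt, ?_, dirichletSol_zero,
    dirichletSol_one hP hs, fun t _ => (dirichletSol_one_sub hP hs t).symm,
    (monotoneOn_dirichletSol hP h0).mono fun t ht => ht.2, fun t ht => ?_⟩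
  · have h : deriv (dirichletSol P) = backSlope P :=
      funext fun t => (hasDerivAt_dirichletSol hP t).deriv
    rw [h]
    exact (continuous_backSlope hP).continuousOn
  · have h1 := mul_backSlope_le_dirichletSol_sub hP h0 ht.1
    rw [dirichletSol_zero, sub_zero, sub_zero] at h1
    have h2 := mul_le_mul_of_nonneg_left (mul_backSlope_zero_le hP hmono ht) ht.1
    have h3 : phi t * normH (dirichletSol P) ≤ phi t * backSlope P 0 :=
      mul_le_mul_of_nonneg_left (normH_dirichletSol_le hP h0 hs)
        (mul_nonneg ht.1 (by linarith [ht.2]))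
    unfold phi at h3 ⊢
    linarith

end Primitive

/-- The even reflection across `1/2` of the superposition `F ∘ w`, multiplied by `g`. -/
noncomputable def reflectedForcing (F g w : ℝ → ℝ) (s : ℝ) : ℝ := F (w (min s (1 - s))) * g s

lemma intervalIntegrable_reflectedForcing {F g w : ℝ → ℝ} (hF : Continuous F) (hw : Continuous w)
    (hg : ∀ a b, IntervalIntegrable g volume a b) (a b : ℝ) :
    IntervalIntegrable (reflectedForcing F g w) volume a b :=
  (hg a b).continuousOn_mul (by fun_prop)

lemma integral_exp_weight {l : ℝ} (hl : 0 < l) (t : ℝ) :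
    ∫ s in t..(1/2:ℝ), Real.exp (l * (1/2 - s)) = (Real.exp (l * (1/2 - t)) - 1) / l := by
  have h : ∀ s ∈ uIcc t (1/2), HasDerivAt (fun s => -(Real.exp (l * (1/2 - s)) / l))
      (Real.exp (l * (1/2 - s))) s := by
    intro s _
    have h1 : HasDerivAt (fun s : ℝ => l * (1/2 - s)) (-l) s := by
      simpa only [id, mul_neg, mul_one] using ((hasDerivAt_id s).const_sub (1/2)).const_mul l
    have h2 := (h1.exp.div_const l).neg
    refine h2.congr_deriv ?_
    field_simp
  rw [intervalIntegral.integral_eq_sub_of_hasDerivAt h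
    ((by fun_prop : Continuous fun s : ℝ => Real.exp (l * (1/2 - s))).intervalIntegrable _ _)]
  simp
  ring

lemma abs_integral_le_of_abs_le_exp {l c t : ℝ} (hl : 0 < l) (hc : 0 ≤ c) (ht : t ≤ 1/2)
    {h : ℝ → ℝ} (hh : ∀ s ∈ Icc t (1/2), |h s| ≤ c * Real.exp (l * (1/2 - s))) :
    |∫ s in t..(1/2:ℝ), h s| ≤ c / l * Real.exp (l * (1/2 - t)) := by
  have hi : IntervalIntegrable (fun s : ℝ => c * Real.exp (l * (1/2 - s))) volume t (1/2) :=
    Continuous.intervalIntegrable (by fun_prop) _ _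
  have h1 := intervalIntegral.norm_integral_le_of_norm_le (f := h) ht
    (.of_forall fun s hs => hh s ⟨hs.1.le, hs.2⟩) hi
  rw [intervalIntegral.integral_const_mul, integral_exp_weight hl, Real.norm_eq_abs] at h1
  refine h1.trans ?_
  rw [mul_div_assoc', div_mul_eq_mul_div]
  gcongr
  linarith

/-- Solutions of the initial value problem at the midpoint with prescribed value `a` and zero
slope, depending continuously on `a`. -/
lemma exists_shooting {F g : ℝ → ℝ} {K M : ℝ} (hK : 0 ≤ K) (hM : 0 ≤ M)
    (hFc : Continuous F) (hF : ∀ x y, |F x - F y| ≤ K * |x - y|)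
    (hg : ∀ a b, IntervalIntegrable g volume a b) (hgM : ∀ s, |g s| ≤ M) :
    ∃ V : ℝ → ℝ → ℝ, (∀ a, Continuous (V a)) ∧ Continuous (fun a => V a 0) ∧
      (∀ a, V a (1/2) = a) ∧ ∀ a, ∀ t ∈ Icc (0:ℝ) (1/2),
        V a t = V a 0 + dirichletSol (reflectedForcing F g (V a)) t := by
  have h01 : (0:ℝ) ≤ 1/2 := by norm_num
  set l : ℝ := 2 * (K * M) + 1 with hl_def
  have hKM : 0 ≤ K * M := mul_nonneg hK hM
  have hl : 0 < l := by positivity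
  have hl2 : K * M / l / l ≤ 1/2 := by
    rw [div_div, div_le_iff₀ (by positivity)]
    nlinarith
  let W : C(Icc (0:ℝ) (1/2), ℝ) → ℝ → ℝ := fun z s =>
    Real.exp (l * (1/2 - s)) * IccExtend h01 z s
  have hWc : ∀ z, Continuous (W z) := fun z =>
    (by fun_prop : Continuous fun s : ℝ => Real.exp (l * (1/2 - s))).mul z.continuous.Icc_extend'
  let Q : C(Icc (0:ℝ) (1/2), ℝ) → ℝ → ℝ := fun z => reflectedForcing F g (W z)
  have hQ : ∀ z a b, IntervalIntegrable (Q z) volume a b := fun z =>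
    intervalIntegrable_reflectedForcing hFc (hWc z) hg
  have hUc : ∀ z, Continuous (dirichletSol (Q z)) := fun z =>
    continuous_iff_continuousAt.2 fun t => (hasDerivAt_dirichletSol (hQ z) t).continuousAt
  let T : ℝ → C(Icc (0:ℝ) (1/2), ℝ) → C(Icc (0:ℝ) (1/2), ℝ) := fun a z =>
    ⟨fun t => Real.exp (-(l * (1/2 - (t:ℝ)))) *
      (a - (dirichletSol (Q z) (1/2) - dirichletSol (Q z) t)), by
        have := hUc z
        fun_prop⟩
  have hQdiff : ∀ z₁ z₂, ∀ s ∈ Icc (0:ℝ) (1/2),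
      |Q z₁ s - Q z₂ s| ≤ K * M * dist z₁ z₂ * Real.exp (l * (1/2 - s)) := by
    intro z₁ z₂ s hs
    have hmin : min s (1 - s) = s := min_eq_left (by linarith [hs.2])
    have h1 : Q z₁ s - Q z₂ s = (F (W z₁ s) - F (W z₂ s)) * g s := by
      simp only [Q, reflectedForcing, hmin]
      ring
    have h2 : |W z₁ s - W z₂ s| ≤ Real.exp (l * (1/2 - s)) * dist z₁ z₂ := by
      simp only [W, ← mul_sub, abs_mul, Real.abs_exp]
      gcongr
      exact ContinuousMap.dist_apply_le_dist (f := z₁) (g := z₂) _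
    rw [h1, abs_mul]
    calc _ ≤ K * (Real.exp (l * (1/2 - s)) * dist z₁ z₂) * M :=
          mul_le_mul ((hF _ _).trans (mul_le_mul_of_nonneg_left h2 hK)) (hgM s) (abs_nonneg _)
            (by positivity)
      _ = _ := by ring
  have hHdiff : ∀ z₁ z₂, ∀ y ∈ Icc (0:ℝ) (1/2), |backSlope (Q z₁) y - backSlope (Q z₂) y|
      ≤ K * M * dist z₁ z₂ / l * Real.exp (l * (1/2 - y)) := by
    intro z₁ z₂ y hy
    rw [backSlope, backSlope, ← intervalIntegral.integral_sub (hQ _ _ _) (hQ _ _ _)]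
    exact abs_integral_le_of_abs_le_exp hl (by positivity) hy.2
      fun s hs => hQdiff _ _ s ⟨hy.1.trans hs.1, hs.2⟩
  have hTdiff : ∀ a z₁ z₂, dist (T a z₁) (T a z₂) ≤ 1/2 * dist z₁ z₂ := by
    intro a z₁ z₂
    rw [ContinuousMap.dist_le (by positivity)]
    intro t
    have h1 : |∫ y in (t:ℝ)..(1/2), (backSlope (Q z₁) y - backSlope (Q z₂) y)|
        ≤ K * M * dist z₁ z₂ / l / l * Real.exp (l * (1/2 - t)) :=
      abs_integral_le_of_abs_le_exp hl (by positivity) t.2.2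
        fun y hy => hHdiff _ _ y ⟨t.2.1.trans hy.1, hy.2⟩
    have hi : ∀ z, IntervalIntegrable (backSlope (Q z)) volume t (1/2) := fun z =>
      (continuous_backSlope (hQ z)).intervalIntegrable _ _
    rw [intervalIntegral.integral_sub (hi _) (hi _), ← dirichletSol_sub (hQ _),
      ← dirichletSol_sub (hQ _)] at h1
    have h2 : T a z₁ t - T a z₂ t = -(Real.exp (-(l * (1/2 - (t:ℝ)))) *
        (dirichletSol (Q z₁) (1/2) - dirichletSol (Q z₁) t -
          (dirichletSol (Q z₂) (1/2) - dirichletSol (Q z₂) t))) := by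
      simp only [T, ContinuousMap.coe_mk]
      ring
    rw [Real.dist_eq, h2, abs_neg, abs_mul, Real.abs_exp]
    calc _ ≤ Real.exp (-(l * (1/2 - (t:ℝ)))) *
          (K * M * dist z₁ z₂ / l / l * Real.exp (l * (1/2 - t))) := by gcongr
      _ = K * M / l / l * dist z₁ z₂ *
          (Real.exp (-(l * (1/2 - (t:ℝ)))) * Real.exp (l * (1/2 - t))) := by ring
      _ = K * M / l / l * dist z₁ z₂ := by rw [← Real.exp_add]; simp
      _ ≤ _ := by gcongr
  have hT : ∀ a, ContractingWith (1/2) (T a) := fun a =>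
    ⟨by rw [← NNReal.coe_lt_coe]; norm_num,
      LipschitzWith.of_dist_le_mul fun z₁ z₂ => by simpa using hTdiff a z₁ z₂⟩
  have hTa : ∀ a b z, dist (T a z) (T b z) ≤ |a - b| := by
    intro a b z
    rw [ContinuousMap.dist_le (abs_nonneg _)]
    intro t
    have h2 : T a z t - T b z t = Real.exp (-(l * (1/2 - (t:ℝ)))) * (a - b) := by
      simp only [T, ContinuousMap.coe_mk]
      ring
    rw [Real.dist_eq, h2, abs_mul, Real.abs_exp]
    refine mul_le_of_le_one_left (abs_nonneg _) (Real.exp_le_one_iff.2 ?_)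
    have := mul_nonneg hl.le (sub_nonneg.2 t.2.2)
    linarith
  let Z : ℝ → C(Icc (0:ℝ) (1/2), ℝ) := fun a => (hT a).fixedPoint
  have hZ : ∀ a, T a (Z a) = Z a := fun a => (hT a).fixedPoint_isFixedPt
  have hV : ∀ a, ∀ t ∈ Icc (0:ℝ) (1/2),
      W (Z a) t = a - (dirichletSol (Q (Z a)) (1/2) - dirichletSol (Q (Z a)) t) := by
    intro a t ht
    have h1 := DFunLike.congr_fun (hZ a) ⟨t, ht⟩
    simp only [T, ContinuousMap.coe_mk] at h1
    simp only [W, IccExtend_of_mem _ _ ht]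
    rw [← h1, ← mul_assoc, ← Real.exp_add]
    simp
  refine ⟨fun a => W (Z a), fun a => hWc _, ?_, fun a => ?_, fun a t ht => ?_⟩
  · have hZc : Continuous Z := by
      refine (LipschitzWith.of_dist_le_mul (K := 2) fun a b => ?_).continuous
      have h := (hT a).fixedPoint_lipschitz_in_map (hT b) (hTa a b)
      refine h.trans_eq ?_
      rw [Real.dist_eq]
      norm_num
      ring
    have h0 : ∀ a, W (Z a) 0 = Real.exp (l * (1/2 - 0)) * Z a ⟨0, by norm_num⟩ := fun a => by
      simp only [W, IccExtend_of_mem h01 _ (show (0:ℝ) ∈ Icc 0 (1/2) by norm_num)]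
    simp only [h0]
    exact continuous_const.mul ((continuous_eval_const _).comp hZc)
  · simpa using hV a (1/2) (by norm_num)
  · have h1 := hV a t ht
    have h2 := hV a 0 (by norm_num)
    rw [dirichletSol_zero] at h2
    change W (Z a) t = W (Z a) 0 + dirichletSol (Q (Z a)) t
    linarith

lemma mul_le_mul_of_le_mul_deriv {f : ℝ → ℝ} (hf : ContDiff ℝ 1 f) {R : ℝ}
    (h : ∀ t ∈ Ioc 0 R, f t ≤ t * deriv f t) {x y : ℝ} (hx : 0 < x) (hxy : x ≤ y) (hy : y ≤ R) :
    f x * y ≤ f y * x := by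
  have hd : ∀ t, 0 < t → HasDerivAt (fun t => f t / t) ((deriv f t * t - f t * 1) / t ^ 2) t :=
    fun t ht => ((hf.differentiable one_ne_zero t).hasDerivAt).div (hasDerivAt_id t) ht.ne'
  have hm : MonotoneOn (fun t => f t / t) (Ioc 0 R) := by
    refine monotoneOn_of_deriv_nonneg (convex_Ioc 0 R)
      (fun t ht => (hd t ht.1).continuousAt.continuousWithinAt)
      (fun t ht => (hd t (interior_subset ht).1).differentiableAt.differentiableWithinAt)
      fun t ht => ?_
    have ht' := interior_subset ht
    rw [(hd t ht'.1).deriv]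
    exact div_nonneg (by linarith [h t ht']) (sq_nonneg t)
  have h1 := hm ⟨hx, hxy.trans hy⟩ ⟨hx.trans_le hxy, hy⟩ hxy
  exact (div_le_div_iff₀ hx (hx.trans_le hxy)).1 h1

lemma integral_le_sqrt_integral_sq {g : ℝ → ℝ} (hg : IntervalIntegrable g volume 0 1)
    (hg2 : IntervalIntegrable (fun t => g t ^ 2) volume 0 1) :
    ∫ t in (0:ℝ)..1, g t ≤ Real.sqrt (∫ t in (0:ℝ)..1, g t ^ 2) := by
  refine Real.le_sqrt_of_sq_le ?_
  set m := ∫ t in (0:ℝ)..1, g t with hm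
  have h := intervalIntegral.integral_mono_on (μ := volume) zero_le_one
    ((hg.const_mul (2 * m)).sub (intervalIntegrable_const (c := m ^ 2))) hg2
    fun x _ => by nlinarith [sq_nonneg (g x - m)]
  rw [intervalIntegral.integral_sub (hg.const_mul _) intervalIntegrable_const,
    intervalIntegral.integral_const_mul, ← hm] at h
  simp only [intervalIntegral.integral_const, smul_eq_mul] at h
  linarith

lemma intervalIntegrable_of_measurable_of_abs_le {g : ℝ → ℝ} (hg : Measurable g) {M : ℝ}
    (hM : ∀ s, |g s| ≤ M) (a b : ℝ) : IntervalIntegrable g volume a b :=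
  (intervalIntegrable_const (c := M)).mono_fun' hg.aestronglyMeasurable (.of_forall hM)

lemma exists_lipschitz_clamp {f : ℝ → ℝ} (hf : ContDiff ℝ 1 f) (R : ℝ) :
    ∃ K : ℝ, 0 ≤ K ∧ ∀ x y, |f (max 0 (min x R)) - f (max 0 (min y R))| ≤ K * |x - y| := by
  obtain ⟨K, hK⟩ := (hf.locallyLipschitz.locallyLipschitzOn
    (s := Icc 0 (max 0 R))).exists_lipschitzOnWith_of_compact isCompact_Icc
  have hmem : ∀ x, max 0 (min x R) ∈ Icc 0 (max 0 R) := fun x =>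
    ⟨le_max_left _ _, max_le_max le_rfl (min_le_right _ _)⟩
  refine ⟨K, K.2, fun x y => ?_⟩
  have h1 := hK.dist_le_mul _ (hmem x) _ (hmem y)
  rw [Real.dist_eq, Real.dist_eq] at h1
  refine h1.trans (mul_le_mul_of_nonneg_left ?_ K.2)
  rw [max_comm 0, max_comm 0]
  refine (abs_max_sub_max_le_abs _ _ _).trans ?_
  simpa using abs_min_sub_min_le_max x R y R

/-- Under (H1) and (H2), the Dirichlet problem `-u'' = g f(u)`,
`u(0) = u(1) = 0`, has a positive symmetric solution localized in the annular
conical set `{ u ∈ K : r < ‖u‖ < R }`. -/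
theorem dirichlet_solution_of_H1_H2
    (f : ℝ → ℝ) (hf : ContDiff ℝ 1 f)
    (hfmono : MonotoneOn f (Ici (0:ℝ)))
    (hf0 : 0 ≤ f 0) (hfpos : ∀ t : ℝ, 0 < t → 0 < f t)
    (g : ℝ → ℝ) (hgnonneg : ∀ t ∈ Icc (0:ℝ) 1, 0 ≤ g t)
    (hgbdd : ∃ M : ℝ, ∀ t ∈ Icc (0:ℝ) 1, g t ≤ M)
    (hgmeas : Measurable g)
    (hgmono : MonotoneOn g (Icc (0:ℝ) (1/2)))
    (hgsymm : ∀ t ∈ Icc (0:ℝ) (1/2), g t = g (1 - t))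
    (r R : ℝ) (hr : 0 < r) (hrR : r < R)
    (β : ℝ) (hβ : β ∈ Ioo (0:ℝ) (1/4))
    (Atil Ctil : ℝ)
    (hAtil : Atil = Real.sqrt (∫ t in (0:ℝ)..1, g t ^ 2))
    (hCtil : Ctil = ∫ t in β..(1/2:ℝ), g t)
    -- condition (H1)
    (hApos : 0 < Atil) (hCpos : 0 < Ctil)
    (hH1r : f r / r < Real.pi / Atil)
    (hH1R : f (R * phi β) / R > 1 / (2 * phi β * Ctil))
    -- condition (H2)
    (θ : ℝ → ℝ) (hθcont : ContinuousOn θ (Icc 0 R))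
    (hθpos : ∀ t ∈ Ioc (0:ℝ) R, 0 < θ t)
    (hAR : ∀ t ∈ Icc (0:ℝ) R, θ t ≤ t * deriv f t - f t) :
    ∃ u : ℝ → ℝ, memK u ∧ r < normH u ∧ normH u < R ∧
      ∀ t ∈ Icc (0:ℝ) 1, u t = ∫ s in (0:ℝ)..1, G t s * f (u s) * g s := by
  have hR : 0 < R := hr.trans hrR
  obtain ⟨hβ0, hβ4⟩ := hβ
  have hφ : 0 < phi β := mul_pos hβ0 (by linarith)
  have hφβ : phi β ≤ 2 * β := by unfold phi; nlinarith
  -- monotonicity of `f x / x`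
  have hθ : ∀ t ∈ Ioc 0 R, f t ≤ t * deriv f t := fun t ht => by
    linarith [hθpos t ht, hAR t ⟨ht.1.le, ht.2⟩]
  have hratio : ∀ x, R * phi β ≤ x → x ≤ R → 2 * x < β * (f x * Ctil) := by
    intro x hx hxR
    have hRφ : 0 < R * phi β := mul_pos hR hφ
    have hx0 : 0 < x := hRφ.trans_le hx
    have h1 := mul_le_mul_of_le_mul_deriv hf hθ hRφ hx hxR
    have h2 : R < f (R * phi β) * (2 * phi β * Ctil) := by
      have h := (div_lt_div_iff₀ (by positivity) hR).1 hH1R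
      linarith
    have h3 : x < f x * Ctil * (2 * phi β ^ 2) := by
      have h4 : R * x < R * (f x * Ctil * (2 * phi β ^ 2)) := by
        have h5 := mul_lt_mul_of_pos_right h2 hx0
        have h6 := mul_le_mul_of_nonneg_left h1 (by positivity : 0 ≤ 2 * phi β * Ctil)
        nlinarith
      exact lt_of_mul_lt_mul_left h4 hR.le
    have h7 : 0 < f x * Ctil := mul_pos (hfpos x hx0) hCpos
    have h8 : 4 * phi β ^ 2 ≤ β := by
      have : phi β ≤ β := by unfold phi; nlinarith
      nlinarith
    nlinarith
  -- truncations of `f` and `g`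
  set F : ℝ → ℝ := fun x => f (max 0 (min x R)) with hFdef
  have hFc : Continuous F := hf.continuous.comp (by fun_prop)
  have hFmono : Monotone F := fun x y hxy =>
    hfmono (mem_Ici.2 (le_max_left _ _)) (mem_Ici.2 (le_max_left _ _)) (max_le_max le_rfl (min_le_min hxy le_rfl))
  have hF0 : ∀ x, 0 ≤ F x := fun x =>
    hf0.trans (hfmono self_mem_Ici (mem_Ici.2 (le_max_left _ _)) (le_max_left _ _))
  have hFf : ∀ x ∈ Icc 0 R, F x = f x := fun x hx => by
    simp only [hFdef, min_eq_left hx.2, max_eq_right hx.1]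
  obtain ⟨K, hK, hFK⟩ := exists_lipschitz_clamp hf R
  obtain ⟨M, hM⟩ := hgbdd
  set k : ℝ → ℝ := indicator (Icc 0 1) g with hkdef
  have hkg : ∀ s ∈ Icc (0:ℝ) 1, k s = g s := fun s hs => indicator_of_mem hs g
  have hk0 : ∀ s, 0 ≤ k s := fun s => indicator_nonneg hgnonneg s
  have hM0 : 0 ≤ M := (hgnonneg 0 (by norm_num)).trans (hM 0 (by norm_num))
  have hkM : ∀ s, |k s| ≤ M := fun s => by
    rw [abs_of_nonneg (hk0 s)]
    exact indicator_apply_le' (hM s) fun _ => hM0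
  have hkmeas : Measurable k := hgmeas.indicator measurableSet_Icc
  have hki := intervalIntegrable_of_measurable_of_abs_le hkmeas hkM
  have hks : ∀ s, k (1 - s) = k s := by
    intro s
    by_cases hs : s ∈ Icc (0:ℝ) 1
    · have hs' : 1 - s ∈ Icc (0:ℝ) 1 := ⟨by linarith [hs.2], by linarith [hs.1]⟩
      rw [hkg _ hs, hkg _ hs']
      rcases le_total s (1/2) with h | h
      · exact (hgsymm s ⟨hs.1, h⟩).symm
      · have h1 := hgsymm (1 - s) ⟨hs'.1, by linarith⟩
        rwa [sub_sub_cancel] at h1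
    · have hs' : 1 - s ∉ Icc (0:ℝ) 1 := fun h => hs ⟨by linarith [h.2], by linarith [h.1]⟩
      rw [hkdef, indicator_of_notMem hs, indicator_of_notMem hs']
  have hkA : 2 * backSlope k 0 ≤ Atil := by
    have h1 := backSlope_one_sub hks 0
    have h2 := backSlope_sub hki 0 1
    rw [sub_zero] at h1
    have h3 := integral_le_sqrt_integral_sq (hki 0 1)
      (intervalIntegrable_of_measurable_of_abs_le (hkmeas.pow_const 2) (M := M ^ 2)
        (fun s => by rw [abs_pow]; exact pow_le_pow_left₀ (abs_nonneg _) (hkM s) 2) 0 1)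
    have h4 : ∫ t in (0:ℝ)..1, k t ^ 2 = ∫ t in (0:ℝ)..1, g t ^ 2 :=
      intervalIntegral.integral_congr fun s hs => by
        rw [uIcc_of_le zero_le_one] at hs
        simp only [hkg s hs]
    rw [h4, ← hAtil] at h3
    linarith
  have hkC : backSlope k β = Ctil := by
    rw [hCtil]
    refine intervalIntegral.integral_congr fun s hs => hkg s ?_
    rw [uIcc_of_le (by linarith)] at hs
    exact ⟨hβ0.le.trans hs.1, hs.2.trans (by norm_num)⟩
  obtain ⟨V, hVc, hV0c, hVa, hV⟩ := exists_shooting hK hM0 hFc hFK hki hkM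
  set P : ℝ → ℝ → ℝ := fun a => reflectedForcing F k (V a) with hPdef
  have hPi : ∀ a b c, IntervalIntegrable (P a) volume b c := fun a =>
    intervalIntegrable_reflectedForcing hFc (hVc a) hki
  have hP0 : ∀ a s, 0 ≤ P a s := fun a s => mul_nonneg (hF0 _) (hk0 s)
  have hPs : ∀ a s, P a (1 - s) = P a s := fun a s => by
    simp only [hPdef, reflectedForcing, hks, sub_sub_cancel, min_comm]
  have hPhalf : ∀ a, ∀ s ≤ (1/2:ℝ), P a s = F (V a s) * k s := fun a s hs => by
    simp only [hPdef, reflectedForcing, min_eq_left (show s ≤ 1 - s by linarith)]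
  have hVmono : ∀ a, MonotoneOn (V a) (Icc 0 (1/2)) := by
    intro a s hs t ht hst
    rw [hV a s hs, hV a t ht]
    have := monotoneOn_dirichletSol (hPi a) (hP0 a) (mem_Iic.2 hs.2) (mem_Iic.2 ht.2) hst
    linarith
  have hVle : ∀ a, ∀ s ∈ Icc (0:ℝ) (1/2), V a s ≤ a := fun a s hs =>
    (hVmono a hs (by norm_num) hs.2).trans_eq (hVa a)
  have hβI : β ∈ Icc (0:ℝ) (1/2) := ⟨hβ0.le, by linarith⟩
  -- a profile starting from a nonnegative value cannot be large at `β`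
  have hsmall : ∀ a ≤ R, 0 ≤ V a 0 → V a β < R * phi β := by
    intro a haR h0
    by_contra! hcon
    have hVβ : V a β ≤ R := (hVle a β hβI).trans haR
    have h1 := hratio _ hcon hVβ
    have hFβ : F (V a β) = f (V a β) := hFf _ ⟨(mul_pos hR hφ).le.trans hcon, hVβ⟩
    have h2 : f (V a β) * Ctil ≤ backSlope (P a) β := by
      rw [← hkC, ← hFβ, backSlope, backSlope, ← intervalIntegral.integral_const_mul]
      refine intervalIntegral.integral_mono_on hβI.2 ((hki _ _).const_mul _) (hPi a _ _)
        fun s hs => ?_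
      rw [hPhalf a s hs.2]
      exact mul_le_mul_of_nonneg_right
        (hFmono (hVmono a hβI ⟨hβ0.le.trans hs.1, hs.2⟩ hs.1)) (hk0 s)
    have h3 := mul_backSlope_le_dirichletSol_sub (hPi a) (hP0 a) hβ0.le
    rw [dirichletSol_zero, sub_zero, sub_zero] at h3
    have h4 := mul_le_mul_of_nonneg_left h2 hβ0.le
    have h5 := hV a β hβI
    change V a β = V a 0 + dirichletSol (P a) β at h5
    linarith [mul_pos hR hφ]
  have hVR : V R 0 < 0 := by
    by_contra! h0
    refine (hsmall R le_rfl h0).not_ge ?_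
    have h1 := mul_backSlope_le_dirichletSol_sub (hPi R) (hP0 R) hβ0.le
    have h2 := dirichletSol_sub_le_mul_backSlope (hPi R) (hP0 R) hβI.2
    have h3 := hV R β hβI
    have h4 := hV R (1/2) (by norm_num)
    rw [hVa] at h4
    change V R β = V R 0 + dirichletSol (P R) β at h3
    change R = V R 0 + dirichletSol (P R) (1/2) at h4
    rw [dirichletSol_zero] at h1
    have h5 := mul_le_mul_of_nonneg_left h2 hβ0.le
    have h6 := mul_le_mul_of_nonneg_left h1 (sub_nonneg.2 hβI.2)
    have h7 : 2 * β * R ≤ V R β := by nlinarith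
    nlinarith
  have hVr : 0 < V r 0 := by
    have h1 := dirichletSol_sub_le_mul_backSlope (hPi r) (hP0 r)
      (show (0:ℝ) ≤ 1/2 by norm_num)
    have h2 : backSlope (P r) 0 ≤ f r * backSlope k 0 := by
      rw [← hFf r ⟨hr.le, hrR.le⟩, backSlope, backSlope, ← intervalIntegral.integral_const_mul]
      refine intervalIntegral.integral_mono_on (by norm_num) (hPi r _ _) ((hki _ _).const_mul _)
        fun s hs => ?_
      rw [hPhalf r s hs.2]
      exact mul_le_mul_of_nonneg_right (hFmono (hVle r s hs)) (hk0 s)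
    have h3 := hV r (1/2) (by norm_num)
    rw [hVa] at h3
    change r = V r 0 + dirichletSol (P r) (1/2) at h3
    have h4 := (div_lt_div_iff₀ hr hApos).1 hH1r
    have h5 := mul_le_mul_of_nonneg_left hkA (hfpos r hr).le
    have h6 := mul_lt_mul_of_pos_right Real.pi_lt_four hr
    rw [dirichletSol_zero] at h1
    linarith
  obtain ⟨a, ⟨hra, haR⟩, ha0⟩ :=
    intermediate_value_Ioo' hrR.le hV0c.continuousOn (show (0:ℝ) ∈ Ioo _ _ from ⟨hVR, hVr⟩)
  replace ha0 : V a 0 = 0 := ha0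
  have hVu : ∀ t ∈ Icc (0:ℝ) (1/2), V a t = dirichletSol (P a) t := fun t ht => by
    rw [hV a t ht, ha0, zero_add]
  have hVI : ∀ t ∈ Icc (0:ℝ) (1/2), V a t ∈ Icc 0 R := fun t ht =>
    ⟨ha0.symm.le.trans (hVmono a (by norm_num) ht ht.1), (hVle a t ht).trans haR.le⟩
  have hPmono : MonotoneOn (P a) (Icc 0 (1/2)) := by
    intro s hs t ht hst
    rw [hPhalf a s hs.2, hPhalf a t ht.2, hkg s ⟨hs.1, hs.2.trans (by norm_num)⟩,
      hkg t ⟨ht.1, ht.2.trans (by norm_num)⟩]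
    exact mul_le_mul (hFmono (hVmono a hs ht hst)) (hgmono hs ht hst)
      (hgnonneg s ⟨hs.1, hs.2.trans (by norm_num)⟩) (hF0 _)
  have hK' := memK_dirichletSol (hPi a) (hP0 a) (hPs a) hPmono
  refine ⟨dirichletSol (P a), hK', ?_, ?_, fun t ht => ?_⟩
  · have h1 := dirichletSol_half_le_normH (hPi a)
    rw [← hVu (1/2) (by norm_num), hVa] at h1
    exact hra.trans_le h1
  · by_contra! hcon
    have h1 := hK'.2.2.2.2.2.2 β hβI
    rw [← hVu β hβI] at h1
    have h2 := hsmall a haR.le ha0.ge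
    nlinarith
  · rw [dirichletSol_eq_integral_G (hPi a) (hPs a) ht]
    refine intervalIntegral.integral_congr fun s hs => ?_
    rw [uIcc_of_le zero_le_one] at hs
    have hm : min s (1 - s) ∈ Icc (0:ℝ) (1/2) := by
      refine ⟨le_min hs.1 (by linarith [hs.2]), ?_⟩
      rcases le_total s (1/2) with h | h
      · exact (min_le_left _ _).trans h
      · exact (min_le_right _ _).trans (by linarith)
    have hu : dirichletSol (P a) s = V a (min s (1 - s)) := by
      rw [hVu _ hm]
      rcases min_choice s (1 - s) with h | h <;> rw [h]
      exact (dirichletSol_one_sub (hPi a) (hPs a) s).symm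
    have hPa : P a s = f (dirichletSol (P a) s) * g s := by
      rw [hu, ← hFf _ (hVI _ hm), ← hkg s hs]
      rfl
    change G t s * P a s = G t s * f (dirichletSol (P a) s) * g s
    rw [mul_assoc, ← hPa]
end

section
/- Assume (H1): Ã > 0, C̃ > 0, f(r)/r < π/Ã, and f(Rφ(β))/R > 1/(2φ(β)C̃); and assume (H3): there exist μ > 1 and λ > 0 such that t f'(t) − μ f(t) ≥ 0 and f'(t) ≥ λ for all t ∈ [rφ(β), R], and B̃ f(rφ(β)) < λ C̃ (1 − 1/μ) r φ(β). Then there exists u* ∈ K with r < ‖u*‖ < R satisfying u*(t) = ∫₀¹ G(t,s) f(u*(s)) g(s) ds for all t ∈ [0,1]; that is, u* is a positive symmetric solution of the Dirichlet problem −u'' = g f(u) on [0,1], u(0) = u(1) = 0, localized in the annular conical set { u ∈ K : r < ‖u‖ < R }. -/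
open Set

open Set MeasureTheory Filter Topology

/-- Integration by parts for the primitive of a bounded measurable function. -/
theorem integral_primitive_mul_add {q₁ q₂ v : ℝ → ℝ} {a c : ℝ}
    (h₁ : ∀ x y, IntervalIntegrable q₁ volume x y) (h₂ : ∀ x y, IntervalIntegrable q₂ volume x y)
    (hv : ∀ x, v x = c + ∫ s in (0 : ℝ)..x, q₂ s) :
    ∫ x in (0 : ℝ)..a, (q₁ x * v x + (∫ s in (0 : ℝ)..x, q₁ s) * q₂ x) =
      (∫ s in (0 : ℝ)..a, q₁ s) * v a := by
  have hv' : v = fun x => c + ∫ s in (0 : ℝ)..x, q₂ s := funext hv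
  have ac₁ : AbsolutelyContinuousOnInterval (fun x => ∫ s in (0 : ℝ)..x, q₁ s) 0 a :=
    (h₁ 0 a).absolutelyContinuousOnInterval_intervalIntegral (by simp)
  have ac₂ : AbsolutelyContinuousOnInterval v 0 a := by
    rw [hv']
    exact (AbsolutelyContinuousOnInterval.fun_add
      (LipschitzWith.const c).lipschitzOnWith.absolutelyContinuousOnInterval
      ((h₂ 0 a).absolutelyContinuousOnInterval_intervalIntegral (by simp)))
  have key := ac₁.integral_deriv_mul_eq_sub ac₂
  simp only [intervalIntegral.integral_same, zero_mul, sub_zero] at key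
  rw [← key]
  apply intervalIntegral.integral_congr_ae
  filter_upwards [(h₁ 0 a).ae_hasDerivAt_integral, (h₂ 0 a).ae_hasDerivAt_integral]
    with x hx₁ hx₂ hx
  have hx' := uIoc_subset_uIcc hx
  have e₂ : deriv v x = q₂ x := by
    rw [hv']
    exact ((hx₂ hx' 0 (by simp)).const_add c).deriv
  rw [(hx₁ hx' 0 (by simp)).deriv, e₂]

theorem hasDerivAt_of_abs_le_sq {F : ℝ → ℝ} {c C x : ℝ}
    (h : ∀ y, |F y - F x - (y - x) * c| ≤ C * (y - x) ^ 2) : HasDerivAt F c x := by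
  rw [hasDerivAt_iff_isLittleO]
  have h1 : (fun y => F y - F x - (y - x) • c) =O[𝓝 x] fun y => (y - x) ^ 2 := by
    refine Asymptotics.IsBigO.of_bound C (Eventually.of_forall fun y => ?_)
    simpa [abs_of_nonneg (sq_nonneg (y - x))] using h y
  refine h1.trans_isLittleO ?_
  simpa using Asymptotics.isLittleO_pow_sub_sub x one_lt_two

theorem hasDerivAt_mul_primitive_sub {q : ℝ → ℝ} {C : ℝ} (hq : Measurable q)
    (hC : ∀ x, |q x| ≤ C) (x : ℝ) :
    HasDerivAt (fun x => x * (∫ s in (0 : ℝ)..x, q s) - ∫ s in (0 : ℝ)..x, s * q s)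
      (∫ s in (0 : ℝ)..x, q s) x := by
  have hC0 : 0 ≤ C := (abs_nonneg _).trans (hC 0)
  have ii : ∀ a b, IntervalIntegrable q volume a b := fun a b =>
    (intervalIntegrable_const (c := C)).mono_fun hq.aestronglyMeasurable
      (Eventually.of_forall fun x => by simpa [abs_of_nonneg hC0] using hC x)
  have ii' : ∀ a b, IntervalIntegrable (fun s => s * q s) volume a b := fun a b =>
    (ii a b).continuousOn_mul continuousOn_id
  refine hasDerivAt_of_abs_le_sq (C := C) fun y => ?_
  have e : y * (∫ s in (0 : ℝ)..y, q s) - (∫ s in (0 : ℝ)..y, s * q s)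
      - (x * (∫ s in (0 : ℝ)..x, q s) - ∫ s in (0 : ℝ)..x, s * q s)
      - (y - x) * (∫ s in (0 : ℝ)..x, q s) = ∫ s in x..y, (y - s) * q s := by
    have e1 := intervalIntegral.integral_interval_sub_left (ii 0 y) (ii 0 x)
    have e2 := intervalIntegral.integral_interval_sub_left (ii' 0 y) (ii' 0 x)
    simp only [sub_mul]
    rw [intervalIntegral.integral_sub ((ii x y).const_mul y) (ii' x y),
      intervalIntegral.integral_const_mul, ← e1, ← e2]
    ring
  rw [e, ← Real.norm_eq_abs]
  have := intervalIntegral.norm_integral_le_of_norm_le_const (a := x) (b := y)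
    (f := fun s => (y - s) * q s) (C := |y - x| * C) (fun s hs => by
      rw [norm_mul]
      refine mul_le_mul ?_ (hC s) (abs_nonneg _) (abs_nonneg _)
      exact abs_sub_right_of_mem_uIcc (uIoc_subset_uIcc hs))
  refine this.trans (le_of_eq ?_)
  rw [← sq_abs (y - x)]; ring

/-- Pairing a nonincreasing weight with the derivative of a nonnegative function that
vanishes at the left endpoint gives a nonnegative integral. -/
theorem integral_antitone_mul_deriv_nonneg {h ψ ψ' : ℝ → ℝ} {a : ℝ} (ha : 0 ≤ a)
    (hh : AntitoneOn h (Icc 0 a)) (hh0 : ∀ x ∈ Icc 0 a, 0 ≤ h x)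
    (hψ : ∀ x, HasDerivAt ψ (ψ' x) x) (hψ' : Continuous ψ')
    (h0 : ψ 0 = 0) (hnn : ∀ x ∈ Icc 0 a, 0 ≤ ψ x) :
    0 ≤ ∫ x in (0 : ℝ)..a, h x * ψ' x := by
  obtain ⟨C, hC⟩ := (isCompact_Icc (a := (0 : ℝ)) (b := a)).exists_bound_of_continuousOn
    hψ'.continuousOn
  have hC0 : 0 ≤ C := (norm_nonneg _).trans (hC 0 ⟨le_rfl, ha⟩)
  have ii : ∀ x ∈ Icc 0 a, ∀ y ∈ Icc 0 a,
      IntervalIntegrable (fun x => h x * ψ' x) volume x y := by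
    intro x hx y hy
    refine IntervalIntegrable.mul_continuousOn ?_ hψ'.continuousOn
    exact (hh.mono (uIcc_subset_Icc hx hy)).intervalIntegrable
  have step : ∀ x ∈ Icc 0 a, ∀ y ∈ Icc 0 a, x ≤ y →
      (∫ s in (0 : ℝ)..x, h s * ψ' s) - h x * ψ x - C * (h x - h y) * (y - x) ≤
        (∫ s in (0 : ℝ)..y, h s * ψ' s) - h y * ψ y := by
    intro x hx y hy hxy
    have e1 := intervalIntegral.integral_interval_sub_left
      (ii 0 ⟨le_rfl, ha⟩ y hy) (ii 0 ⟨le_rfl, ha⟩ x hx)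
    have e2 : ∫ s in x..y, ψ' s = ψ y - ψ x :=
      intervalIntegral.integral_eq_sub_of_hasDerivAt (fun s _ => hψ s)
        (hψ'.intervalIntegrable _ _)
    have e3 : ∫ s in x..y, (h s - h y) * ψ' s =
        (∫ s in x..y, h s * ψ' s) - h y * (ψ y - ψ x) := by
      simp only [sub_mul]
      rw [intervalIntegral.integral_sub (ii x hx y hy)
        ((hψ'.intervalIntegrable _ _).const_mul _), intervalIntegral.integral_const_mul, e2]
    have e4 := intervalIntegral.norm_integral_le_of_norm_le_const (a := x) (b := y)
      (f := fun s => (h s - h y) * ψ' s) (C := (h x - h y) * C) (fun s hs => by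
        rw [uIoc_of_le hxy] at hs
        have hs' : s ∈ Icc 0 a := ⟨hx.1.trans hs.1.le, hs.2.trans hy.2⟩
        have i1 := hh hx hs' hs.1.le
        have i2 := hh hs' hy hs.2
        rw [norm_mul, Real.norm_eq_abs, abs_of_nonneg (by linarith)]
        exact mul_le_mul (by linarith) (hC s hs') (norm_nonneg _) (by linarith))
    rw [Real.norm_eq_abs, abs_of_nonneg (sub_nonneg.2 hxy)] at e4
    have e5 := (abs_le.1 e4).1
    have e6 : 0 ≤ (h x - h y) * ψ x :=
      mul_nonneg (sub_nonneg.2 (hh hx hy hxy)) (hnn x hx)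
    nlinarith
  have bound : ∀ n : ℕ, 0 < n → -(C * (h 0 - h a) * a / n) ≤ ∫ x in (0 : ℝ)..a, h x * ψ' x := by
    intro n hn
    have hn' : (0 : ℝ) < n := by exact_mod_cast hn
    have mem : ∀ i : ℕ, i ≤ n → (i : ℝ) * (a / n) ∈ Icc 0 a := by
      intro i hi
      have hi' : (i : ℝ) ≤ n := by exact_mod_cast hi
      refine ⟨by positivity, ?_⟩
      calc (i : ℝ) * (a / n) ≤ n * (a / n) := by gcongr
        _ = a := by field_simp
    have ind : ∀ i : ℕ, i ≤ n → -(C * (h 0 - h (i * (a / n))) * (a / n)) ≤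
        (∫ s in (0 : ℝ)..(i * (a / n)), h s * ψ' s) - h (i * (a / n)) * ψ (i * (a / n)) := by
      intro i
      induction i with
      | zero => intro _; simp [h0]
      | succ i ih =>
        intro hi
        have := ih (by omega)
        have st := step _ (mem i (by omega)) _ (mem (i + 1) hi) (by
          push_cast
          have : 0 ≤ a / n := by positivity
          nlinarith)
        have hd : ((i + 1 : ℕ) : ℝ) * (a / n) - i * (a / n) = a / n := by push_cast; ring
        rw [hd] at st
        nlinarith
    have fin := ind n le_rfl
    have hna : (n : ℝ) * (a / n) = a := by field_simp
    rw [hna] at fin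
    have : 0 ≤ h a * ψ a := mul_nonneg (hh0 a ⟨ha, le_rfl⟩) (hnn a ⟨ha, le_rfl⟩)
    calc -(C * (h 0 - h a) * a / n) = -(C * (h 0 - h a) * (a / n)) := by ring
      _ ≤ _ := by linarith
  have lim : Tendsto (fun n : ℕ => -(C * (h 0 - h a) * a / n)) atTop (𝓝 0) := by
    simpa using (tendsto_const_div_atTop_nhds_zero_nat (C * (h 0 - h a) * a)).neg
  exact le_of_tendsto lim (eventually_atTop.2 ⟨1, fun n hn => bound n hn⟩)

/-- Wirtinger's inequality on `[0, 1/2]` with a Dirichlet condition at the right endpoint. -/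
theorem wirtinger_half {Y Y' : ℝ → ℝ} (hY : ∀ x, HasDerivAt Y (Y' x) x) (hY' : Continuous Y')
    (h1 : Y (1 / 2) = 0) {c : ℝ} (hc0 : 0 ≤ c) (hc : c < Real.pi) :
    c ^ 2 * ∫ x in (0 : ℝ)..(1 / 2), Y x ^ 2 ≤ ∫ x in (0 : ℝ)..(1 / 2), Y' x ^ 2 := by
  have hYc : Continuous Y := continuous_iff_continuousAt.2 fun x => (hY x).continuousAt
  have hcos : ∀ x ∈ Icc (0 : ℝ) (1 / 2), 0 < Real.cos (c * x) := by
    intro x hx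
    have hpi := Real.pi_pos
    exact Real.cos_pos_of_mem_Ioo ⟨by nlinarith [hx.1, mul_nonneg hc0 hx.1], by nlinarith [hx.1, hx.2]⟩
  have hd : ∀ x ∈ uIcc (0 : ℝ) (1 / 2), HasDerivAt (fun x => c * Real.tan (c * x) * Y x ^ 2)
      ((Y' x + c * Real.tan (c * x) * Y x) ^ 2 - (Y' x ^ 2 - c ^ 2 * Y x ^ 2)) x := by
    intro x hx
    rw [uIcc_of_le (by norm_num)] at hx
    have hne := (hcos x hx).ne'
    have t := (Real.hasDerivAt_tan hne).comp x ((hasDerivAt_id x).const_mul c)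
    have := (t.const_mul c).mul ((hY x).pow 2)
    refine (this.congr_deriv ?_)
    simp only [Function.comp, Real.tan_eq_sin_div_cos]
    have := Real.sin_sq_add_cos_sq (c * x)
    field_simp
    simp
    linear_combination c ^ 2 * (Y x) ^ 2 * (-this)
  have hcont : ContinuousOn (fun x => (Y' x + c * Real.tan (c * x) * Y x) ^ 2)
      (uIcc (0 : ℝ) (1 / 2)) := by
    rw [uIcc_of_le (by norm_num)]
    have : ContinuousOn (fun x => Real.tan (c * x)) (Icc (0 : ℝ) (1 / 2)) := by
      intro x hx
      have := ((Real.continuousAt_tan.2 (hcos x hx).ne').comp (x := x)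
        (f := fun x => c * x) (by fun_prop))
      exact this.continuousWithinAt
    fun_prop
  have i1 := hcont.intervalIntegrable (μ := volume)
  have i2 : IntervalIntegrable (fun x => Y' x ^ 2 - c ^ 2 * Y x ^ 2) volume 0 (1 / 2) :=
    Continuous.intervalIntegrable (by fun_prop) _ _
  have ftc := intervalIntegral.integral_eq_sub_of_hasDerivAt hd (i1.sub i2)
  rw [intervalIntegral.integral_sub i1 i2, intervalIntegral.integral_sub
    (Continuous.intervalIntegrable (by fun_prop) _ _)
    (Continuous.intervalIntegrable (by fun_prop) _ _), intervalIntegral.integral_const_mul] at ftc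
  have nn : 0 ≤ ∫ x in (0 : ℝ)..(1 / 2), (Y' x + c * Real.tan (c * x) * Y x) ^ 2 :=
    intervalIntegral.integral_nonneg (by norm_num) fun x _ => sq_nonneg _
  simp only [h1, mul_zero, Real.tan_zero] at ftc
  norm_num at ftc
  norm_num at nn ⊢
  linarith


/-- A parameter-dependent Volterra equation with bounded Lipschitz nonlinearity has a solution
depending continuously on the parameters. -/
theorem exists_continuous_volterra_solution {P : Type*} [TopologicalSpace P]
    [FirstCountableTopology P] {a b : P → ℝ} (ha : Continuous a) (hb : Continuous b)
    {A B : ℝ} (haA : ∀ p, |a p| ≤ A) (hbB : ∀ p, |b p| ≤ B)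
    {H : ℝ → ℝ} (hH : Measurable H) {M : ℝ} (hHM : ∀ x, |H x| ≤ M)
    {k : ℝ → ℝ} {L : NNReal} (hk : LipschitzWith L k) {N : ℝ} (hkN : ∀ x, |k x| ≤ N) :
    ∃ Y : P → ℝ → ℝ, Continuous (fun p : P × ℝ => Y p.1 p.2) ∧
      ∀ p x, Y p x = a p - b p * ∫ s in (0 : ℝ)..(1 / 2), max (|x| - s) 0 * (H s * k (Y p s)) := by
  rcases isEmpty_or_nonempty P with hP | ⟨⟨p₀⟩⟩
  · exact ⟨fun _ _ => 0, continuous_of_const fun p => (hP.false p.1).elim, fun p => (hP.false p).elim⟩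
  have hA : 0 ≤ A := (abs_nonneg _).trans (haA p₀)
  have hB : 0 ≤ B := (abs_nonneg _).trans (hbB p₀)
  have hM : 0 ≤ M := (abs_nonneg _).trans (hHM 0)
  have hN : 0 ≤ N := (abs_nonneg _).trans (hkN 0)
  have hL : (0 : ℝ) ≤ L := L.2
  have hkc := hk.continuous
  set κ : ℝ := B * M * L + 1 with hκ
  have hκ0 : 0 < κ := by positivity
  have kernel : ∀ x s : ℝ, Real.exp (-κ * |x|) * max (|x| - s) 0 * Real.exp (κ * s) ≤ 1 / κ := by
    intro x s
    rcases le_total (|x| - s) 0 with h | h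
    · rw [max_eq_right h]; simp; positivity
    · rw [max_eq_left h, mul_right_comm, ← Real.exp_add, le_div_iff₀ hκ0]
      have h1 := Real.add_one_le_exp (κ * (|x| - s))
      have h2 : -κ * |x| + κ * s = -(κ * (|x| - s)) := by ring
      rw [h2, Real.exp_neg, mul_assoc, inv_mul_le_iff₀ (Real.exp_pos _)]
      linarith
  have kernel0 : ∀ x s : ℝ, 0 ≤ s → Real.exp (-κ * |x|) * max (|x| - s) 0 ≤ 1 / κ := by
    intro x s hs
    refine le_trans ?_ (kernel x s)
    exact le_mul_of_one_le_right (by positivity) (Real.one_le_exp (by positivity))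
  have meas : ∀ {z : P × ℝ → ℝ}, Continuous z → ∀ p x,
      Measurable fun s => max (|x| - s) 0 * (H s * k (Real.exp (κ * s) * z (p, s))) := by
    intro z hz p x
    have : Continuous fun s => k (Real.exp (κ * s) * z (p, s)) := by fun_prop
    exact (by fun_prop : Continuous fun s : ℝ => max (|x| - s) 0).measurable.mul
      (hH.mul this.measurable)
  have bound : ∀ {z : P × ℝ → ℝ}, ∀ p x s, 0 ≤ s →
      ‖max (|x| - s) 0 * (H s * k (Real.exp (κ * s) * z (p, s)))‖ ≤ |x| * (M * N) := by
    intro z p x s hs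
    rw [norm_mul, norm_mul]
    refine mul_le_mul ?_ (mul_le_mul (hHM s) (hkN _) (norm_nonneg _) hM) (by positivity)
      (abs_nonneg _)
    rw [Real.norm_eq_abs, abs_of_nonneg (le_max_right _ _)]
    exact max_le (by linarith) (abs_nonneg _)
  have half : ∀ {s : ℝ}, s ∈ uIoc (0 : ℝ) (1 / 2) → 0 ≤ s := by
    intro s hs
    rw [uIoc_of_le (by norm_num)] at hs
    exact hs.1.le
  have ii : ∀ {z : P × ℝ → ℝ}, Continuous z → ∀ p x, IntervalIntegrable
      (fun s => max (|x| - s) 0 * (H s * k (Real.exp (κ * s) * z (p, s)))) volume 0 (1 / 2) := by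
    intro z hz p x
    refine (intervalIntegrable_const (c := |x| * (M * N))).mono_fun
      (meas hz p x).aestronglyMeasurable ?_
    refine (ae_restrict_iff' measurableSet_uIoc).2 (Eventually.of_forall fun s hs => ?_)
    exact (bound p x s (half hs)).trans (le_abs_self _)
  have contI : ∀ {z : P × ℝ → ℝ}, Continuous z → Continuous fun q : P × ℝ =>
      ∫ s in (0 : ℝ)..(1 / 2), max (|q.2| - s) 0 * (H s * k (Real.exp (κ * s) * z (q.1, s))) := by
    intro z hz
    rw [continuous_iff_continuousAt]
    intro q₀
    refine intervalIntegral.continuousAt_of_dominated_interval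
      (bound := fun _ => (|q₀.2| + 1) * (M * N)) ?_ ?_ (by simp) ?_
    · exact Eventually.of_forall fun q => (meas hz q.1 q.2).aestronglyMeasurable
    · have : ∀ᶠ q : P × ℝ in 𝓝 q₀, |q.2| < |q₀.2| + 1 :=
        (continuous_snd.abs.continuousAt (x := q₀)).eventually_lt continuousAt_const (by simp)
      filter_upwards [this] with q hq
      refine Eventually.of_forall fun s hs => (bound q.1 q.2 s (half hs)).trans ?_
      gcongr
    · refine Eventually.of_forall fun s _ => ?_
      exact (by fun_prop : Continuous fun q : P × ℝ =>
        max (|q.2| - s) 0 * (H s * k (Real.exp (κ * s) * z (q.1, s)))).continuousAt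
  let T : BoundedContinuousFunction (P × ℝ) ℝ → BoundedContinuousFunction (P × ℝ) ℝ := fun z =>
    BoundedContinuousFunction.ofNormedAddCommGroup
      (fun q => Real.exp (-κ * |q.2|) * (a q.1 - b q.1 * ∫ s in (0 : ℝ)..(1 / 2),
        max (|q.2| - s) 0 * (H s * k (Real.exp (κ * s) * z (q.1, s)))))
      (by
        have := contI z.continuous
        fun_prop)
      (A + B * (1 / κ * (M * N)))
      (by
        intro q
        have e : Real.exp (-κ * |q.2|) * (a q.1 - b q.1 * ∫ s in (0 : ℝ)..(1 / 2),
            max (|q.2| - s) 0 * (H s * k (Real.exp (κ * s) * z (q.1, s)))) =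
            Real.exp (-κ * |q.2|) * a q.1 - b q.1 * ∫ s in (0 : ℝ)..(1 / 2),
            (Real.exp (-κ * |q.2|) * max (|q.2| - s) 0) *
              (H s * k (Real.exp (κ * s) * z (q.1, s))) := by
          simp only [mul_assoc]
          rw [intervalIntegral.integral_const_mul]
          ring
        rw [e]
        refine (norm_sub_le _ _).trans (add_le_add ?_ ?_)
        · rw [norm_mul, Real.norm_eq_abs, abs_of_pos (Real.exp_pos _)]
          have h1 : Real.exp (-κ * |q.2|) ≤ 1 := Real.exp_le_one_iff.2 (by
            have := abs_nonneg q.2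
            nlinarith)
          calc _ ≤ 1 * A := mul_le_mul h1 (haA _) (abs_nonneg _) zero_le_one
            _ = A := one_mul A
        · rw [norm_mul]
          refine mul_le_mul (hbB _) ?_ (norm_nonneg _) hB
          refine (intervalIntegral.norm_integral_le_of_norm_le_const
            (C := 1 / κ * (M * N)) fun s hs => ?_).trans ?_
          · rw [norm_mul, norm_mul (H s)]
            refine mul_le_mul ?_ (mul_le_mul (hHM s) (hkN _) (norm_nonneg _) hM) (by positivity)
              (by positivity)
            rw [Real.norm_eq_abs, abs_of_nonneg (by positivity)]
            exact kernel0 _ _ (half hs)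
          · have : 0 ≤ 1 / κ * (M * N) := by positivity
            norm_num at this ⊢
            linarith)
  have hT : ∀ z q, T z q = Real.exp (-κ * |q.2|) * (a q.1 - b q.1 * ∫ s in (0 : ℝ)..(1 / 2),
      max (|q.2| - s) 0 * (H s * k (Real.exp (κ * s) * z (q.1, s)))) := fun _ _ => rfl
  have contr : ContractingWith (1 / 2) T := by
    refine ⟨by rw [← NNReal.coe_lt_coe]; norm_num, LipschitzWith.of_dist_le_mul fun z₁ z₂ => ?_⟩
    rw [BoundedContinuousFunction.dist_le (by positivity)]
    intro q
    have e : T z₁ q - T z₂ q = -(b q.1 * ∫ s in (0 : ℝ)..(1 / 2), Real.exp (-κ * |q.2|) *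
        (max (|q.2| - s) 0 * (H s * k (Real.exp (κ * s) * z₁ (q.1, s))) -
          max (|q.2| - s) 0 * (H s * k (Real.exp (κ * s) * z₂ (q.1, s))))) := by
      rw [hT, hT, intervalIntegral.integral_const_mul, intervalIntegral.integral_sub
        (ii z₁.continuous _ _) (ii z₂.continuous _ _)]
      ring
    rw [Real.dist_eq, e, abs_neg, abs_mul, ← Real.norm_eq_abs (∫ s in _.._, _)]
    have pt : ∀ s ∈ uIoc (0 : ℝ) (1 / 2), ‖Real.exp (-κ * |q.2|) *
        (max (|q.2| - s) 0 * (H s * k (Real.exp (κ * s) * z₁ (q.1, s))) -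
          max (|q.2| - s) 0 * (H s * k (Real.exp (κ * s) * z₂ (q.1, s))))‖ ≤
          1 / κ * (M * L * dist z₁ z₂) := by
      intro s hs
      have h1 : |k (Real.exp (κ * s) * z₁ (q.1, s)) - k (Real.exp (κ * s) * z₂ (q.1, s))| ≤
          L * (Real.exp (κ * s) * dist z₁ z₂) := by
        have := hk.dist_le_mul (Real.exp (κ * s) * z₁ (q.1, s)) (Real.exp (κ * s) * z₂ (q.1, s))
        rw [Real.dist_eq, Real.dist_eq, ← mul_sub, abs_mul, abs_of_pos (Real.exp_pos _)] at this
        refine this.trans ?_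
        gcongr
        rw [← Real.dist_eq]
        exact BoundedContinuousFunction.dist_coe_le_dist (f := z₁) (g := z₂) (q.1, s)
      have e1 : Real.exp (-κ * |q.2|) *
        (max (|q.2| - s) 0 * (H s * k (Real.exp (κ * s) * z₁ (q.1, s))) -
          max (|q.2| - s) 0 * (H s * k (Real.exp (κ * s) * z₂ (q.1, s)))) =
          (Real.exp (-κ * |q.2|) * max (|q.2| - s) 0) * (H s *
          (k (Real.exp (κ * s) * z₁ (q.1, s)) - k (Real.exp (κ * s) * z₂ (q.1, s)))) := by ring
      rw [e1, norm_mul, norm_mul (H s), Real.norm_eq_abs,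
        abs_of_nonneg (by positivity : 0 ≤ Real.exp (-κ * |q.2|) * max (|q.2| - s) 0)]
      calc _ ≤ Real.exp (-κ * |q.2|) * max (|q.2| - s) 0 *
            (M * (L * (Real.exp (κ * s) * dist z₁ z₂))) := by
              gcongr
              · exact hHM s
              · exact h1
        _ = (Real.exp (-κ * |q.2|) * max (|q.2| - s) 0 * Real.exp (κ * s)) *
            (M * L * dist z₁ z₂) := by ring
        _ ≤ _ := by
          gcongr
          exact kernel _ _
    have h2 := intervalIntegral.norm_integral_le_of_norm_le_const pt
    have h3 : |(1 : ℝ) / 2 - 0| = 1 / 2 := by norm_num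
    rw [h3] at h2
    calc _ ≤ B * (1 / κ * (M * L * dist z₁ z₂) * (1 / 2)) :=
          mul_le_mul (hbB _) h2 (norm_nonneg _) hB
      _ = (B * M * L / κ) * (1 / 2 * dist z₁ z₂) := by ring
      _ ≤ 1 * (1 / 2 * dist z₁ z₂) := by
          gcongr
          rw [div_le_one hκ0]
          linarith
      _ = _ := by push_cast; ring
  have fix : T (contr.fixedPoint T) = contr.fixedPoint T := contr.fixedPoint_isFixedPt
  set z := contr.fixedPoint T with hz
  refine ⟨fun p x => Real.exp (κ * |x|) * z (p, x), by fun_prop, fun p x => ?_⟩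
  have hzx := hT z (p, x)
  rw [fix] at hzx
  simp only at hzx ⊢
  rw [hzx, ← mul_assoc, ← Real.exp_add, neg_mul, add_neg_cancel, Real.exp_zero, one_mul]
  congr 2
  refine intervalIntegral.integral_congr fun s hs => ?_
  rw [uIcc_of_le (by norm_num)] at hs
  simp only [abs_of_nonneg hs.1]

/-- Even weights supported in `[-1/2, 1/2]`, bounded by `M`, nonincreasing away from `0` and
positive near `0`. -/
structure IsWeight (H : ℝ → ℝ) (M : ℝ) : Prop where
  measurable : Measurable H
  nonneg : ∀ x, 0 ≤ H x
  le : ∀ x, H x ≤ M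
  even : ∀ x, H (-x) = H x
  anti : AntitoneOn H (Ici 0)
  support : ∀ x, 1 / 2 < x → H x = 0
  pos : ∃ δ, 0 < δ ∧ 0 < H δ

/-- Continuous nondecreasing nonlinearities with values in `[0, N]`, positive on `(0, ∞)`. -/
structure IsNonlinearity (k : ℝ → ℝ) (N : ℝ) : Prop where
  cont : Continuous k
  mono : Monotone k
  nonneg : ∀ x, 0 ≤ k x
  le : ∀ x, k x ≤ N
  pos : ∀ x, 0 < x → 0 < k x

/-- Even solutions of `-Y'' = lam * H * k(Y)` with `Y(0) = m`, in integrated form. -/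
structure IsProfile (H k : ℝ → ℝ) (m lam : ℝ) (Y : ℝ → ℝ) : Prop where
  cont : Continuous Y
  even : ∀ x, Y (-x) = Y x
  eq : ∀ x, Y x = m - lam * (x * (∫ s in (0 : ℝ)..x, H s * k (Y s)) -
    ∫ s in (0 : ℝ)..x, s * (H s * k (Y s)))

section Profile

variable {H k Y : ℝ → ℝ} {M N m lam : ℝ}

theorem source_measurable (hH : IsWeight H M) (hk : IsNonlinearity k N) (hY : Continuous Y) :
    Measurable fun s => H s * k (Y s) :=
  hH.measurable.mul (hk.cont.comp hY).measurable

theorem source_nonneg (hH : IsWeight H M) (hk : IsNonlinearity k N) (x : ℝ) :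
    0 ≤ H x * k (Y x) :=
  mul_nonneg (hH.nonneg x) (hk.nonneg _)

theorem abs_source_le (hH : IsWeight H M) (hk : IsNonlinearity k N) (x : ℝ) :
    |H x * k (Y x)| ≤ M * N := by
  rw [abs_of_nonneg (source_nonneg hH hk x)]
  exact mul_le_mul (hH.le x) (hk.le _) (hk.nonneg _) ((hH.nonneg x).trans (hH.le x))

theorem source_intervalIntegrable (hH : IsWeight H M) (hk : IsNonlinearity k N)
    (hY : Continuous Y) (a b : ℝ) : IntervalIntegrable (fun s => H s * k (Y s)) volume a b :=
  (intervalIntegrable_const (c := M * N)).mono_fun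
    (source_measurable hH hk hY).aestronglyMeasurable
    (Eventually.of_forall fun x => (abs_source_le hH hk x).trans (le_abs_self _))

theorem IsWeight.intervalIntegrable (hH : IsWeight H M) (a b : ℝ) :
    IntervalIntegrable H volume a b :=
  (intervalIntegrable_const (c := M)).mono_fun hH.measurable.aestronglyMeasurable
    (Eventually.of_forall fun x => by
      simp only [Real.norm_eq_abs, abs_of_nonneg (hH.nonneg x)]
      exact (hH.le x).trans (le_abs_self _))

theorem IsWeight.sq_intervalIntegrable (hH : IsWeight H M) (a b : ℝ) :
    IntervalIntegrable (fun x => H x ^ 2) volume a b :=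
  (intervalIntegrable_const (c := M ^ 2)).mono_fun (hH.measurable.pow_const 2).aestronglyMeasurable
    (Eventually.of_forall fun x => by
      simp only [Real.norm_eq_abs, abs_pow, abs_of_nonneg (hH.nonneg x), sq_abs]
      exact pow_le_pow_left₀ (hH.nonneg x) (hH.le x) 2)

theorem source_primitive_continuous (hH : IsWeight H M) (hk : IsNonlinearity k N)
    (hY : Continuous Y) : Continuous fun x => ∫ s in (0 : ℝ)..x, H s * k (Y s) :=
  intervalIntegral.continuous_primitive (source_intervalIntegrable hH hk hY) 0

theorem source_primitive_monotone (hH : IsWeight H M) (hk : IsNonlinearity k N)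
    (hY : Continuous Y) : Monotone fun x => ∫ s in (0 : ℝ)..x, H s * k (Y s) := by
  intro x y hxy
  have := intervalIntegral.integral_interval_sub_left
    (source_intervalIntegrable hH hk hY 0 y) (source_intervalIntegrable hH hk hY 0 x)
  have h0 : 0 ≤ ∫ s in x..y, H s * k (Y s) :=
    intervalIntegral.integral_nonneg hxy fun s _ => source_nonneg hH hk s
  simp only
  linarith

theorem source_primitive_nonneg (hH : IsWeight H M) (hk : IsNonlinearity k N) {x : ℝ}
    (hx : 0 ≤ x) : 0 ≤ ∫ s in (0 : ℝ)..x, H s * k (Y s) :=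
  intervalIntegral.integral_nonneg hx fun s _ => source_nonneg hH hk s

theorem IsWeight.pos_of_lt (hH : IsWeight H M) : ∃ δ, 0 < δ ∧ ∀ x, 0 ≤ x → x ≤ δ → 0 < H x := by
  obtain ⟨δ, h0, h1⟩ := hH.pos
  exact ⟨δ, h0, fun x hx hxδ => h1.trans_le (hH.anti hx h0.le hxδ)⟩

namespace IsProfile

theorem zero_eq (h : IsProfile H k m lam Y) : Y 0 = m := by
  rw [h.eq]; simp

theorem hasDerivAt (hH : IsWeight H M) (hk : IsNonlinearity k N) (h : IsProfile H k m lam Y)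
    (x : ℝ) : HasDerivAt Y (-(lam * ∫ s in (0 : ℝ)..x, H s * k (Y s))) x := by
  have := ((hasDerivAt_mul_primitive_sub (source_measurable hH hk h.cont)
    (abs_source_le hH hk) x).const_mul lam).const_sub m
  exact this.congr_of_eventuallyEq (Eventually.of_forall h.eq)

theorem primitive_pos (hH : IsWeight H M) (hk : IsNonlinearity k N) (h : IsProfile H k m lam Y)
    (hm : 0 < m) {x : ℝ} (hx : 0 < x) : 0 < ∫ s in (0 : ℝ)..x, H s * k (Y s) := by
  obtain ⟨δ, hδ, hHδ⟩ := hH.pos_of_lt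
  have hev : ∀ᶠ s in 𝓝 (0 : ℝ), 0 < Y s :=
    h.cont.continuousAt.eventually (lt_mem_nhds (by rw [h.zero_eq]; exact hm))
  obtain ⟨ε, hε, hYε⟩ := Metric.eventually_nhds_iff.1 hev
  set c := min x (min δ (ε / 2)) with hc
  have hc0 : 0 < c := lt_min hx (lt_min hδ (by linarith))
  have hcx : c ≤ x := min_le_left _ _
  refine lt_of_lt_of_le ?_ (source_primitive_monotone hH hk h.cont hcx)
  refine intervalIntegral.intervalIntegral_pos_of_pos_on
    (source_intervalIntegrable hH hk h.cont 0 c) (fun s hs => ?_) hc0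
  have h1 : c ≤ δ := (min_le_right _ _).trans (min_le_left _ _)
  have h2 : c ≤ ε / 2 := (min_le_right _ _).trans (min_le_right _ _)
  refine mul_pos (hHδ s hs.1.le (hs.2.le.trans h1)) (hk.pos _ (hYε ?_))
  rw [Real.dist_eq, sub_zero, abs_of_pos hs.1]
  linarith [hs.2]

theorem antitoneOn (hH : IsWeight H M) (hk : IsNonlinearity k N) (h : IsProfile H k m lam Y)
    (hl : 0 ≤ lam) : AntitoneOn Y (Ici 0) := by
  refine antitoneOn_of_deriv_nonpos (convex_Ici 0) h.cont.continuousOn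
    (fun x _ => (h.hasDerivAt hH hk x).differentiableAt.differentiableWithinAt) fun x hx => ?_
  rw [(h.hasDerivAt hH hk x).deriv]
  rw [interior_Ici] at hx
  exact neg_nonpos.2 (mul_nonneg hl (source_primitive_nonneg hH hk (le_of_lt hx)))

theorem energy (hH : IsWeight H M) (hk : IsNonlinearity k N) (h : IsProfile H k m lam Y)
    (a : ℝ) : (∫ s in (0 : ℝ)..a, H s * k (Y s)) ^ 2 =
      2 * ∫ x in (0 : ℝ)..a, H x * (k (Y x) * ∫ s in (0 : ℝ)..x, H s * k (Y s)) := by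
  have ii := source_intervalIntegrable hH hk h.cont
  have := integral_primitive_mul_add (a := a) (c := 0) ii ii (fun x => (zero_add _).symm)
  rw [sq, ← this, ← intervalIntegral.integral_const_mul]
  refine intervalIntegral.integral_congr fun x _ => ?_
  ring

/-- For fixed central value, the slope of a profile is strictly increasing in the parameter. -/
theorem slope_lt (hH : IsWeight H M) (hk : IsNonlinearity k N) {lam₁ lam₂ : ℝ} {Y₁ Y₂ : ℝ → ℝ}
    (h₁ : IsProfile H k m lam₁ Y₁) (h₂ : IsProfile H k m lam₂ Y₂) (hm : 0 < m) (hl : 0 ≤ lam₁)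
    (hlt : lam₁ < lam₂) {x : ℝ} (hx : 0 < x) :
    lam₁ * (∫ s in (0 : ℝ)..x, H s * k (Y₁ s)) < lam₂ * ∫ s in (0 : ℝ)..x, H s * k (Y₂ s) := by
  set e : ℝ → ℝ := fun x => lam₂ * (∫ s in (0 : ℝ)..x, H s * k (Y₂ s)) -
    lam₁ * ∫ s in (0 : ℝ)..x, H s * k (Y₁ s) with he
  have hec : Continuous e := by
    have := source_primitive_continuous hH hk h₁.cont
    have := source_primitive_continuous hH hk h₂.cont
    fun_prop
  have near : ∃ c, 0 < c ∧ ∀ y, 0 < y → y ≤ c → 0 < e y := by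
    obtain ⟨δ, hδ, hHδ⟩ := hH.pos_of_lt
    have hev : ∀ᶠ s in 𝓝 (0 : ℝ), 0 < lam₂ * k (Y₂ s) - lam₁ * k (Y₁ s) := by
      have hc : Continuous fun s => lam₂ * k (Y₂ s) - lam₁ * k (Y₁ s) := by
        have := h₁.cont; have := h₂.cont; have := hk.cont
        fun_prop
      refine hc.continuousAt.eventually (lt_mem_nhds ?_)
      simp only
      rw [h₁.zero_eq, h₂.zero_eq]
      have := hk.pos m hm
      nlinarith
    obtain ⟨ε, hε, hYε⟩ := Metric.eventually_nhds_iff.1 hev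
    refine ⟨min δ (ε / 2), lt_min hδ (by linarith), fun y hy hyc => ?_⟩
    have ii₁ := source_intervalIntegrable hH hk h₁.cont 0 y
    have ii₂ := source_intervalIntegrable hH hk h₂.cont 0 y
    rw [he]
    simp only
    rw [← intervalIntegral.integral_const_mul, ← intervalIntegral.integral_const_mul,
      ← intervalIntegral.integral_sub (ii₂.const_mul _) (ii₁.const_mul _)]
    refine intervalIntegral.intervalIntegral_pos_of_pos_on
      ((ii₂.const_mul _).sub (ii₁.const_mul _)) (fun s hs => ?_) hy
    have h1 : y ≤ δ := hyc.trans (min_le_left _ _)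
    have h2 : y ≤ ε / 2 := hyc.trans (min_le_right _ _)
    have h3 := hHδ s hs.1.le (hs.2.le.trans h1)
    have h4 := hYε (y := s) (by
      rw [Real.dist_eq, sub_zero, abs_of_pos hs.1]
      linarith [hs.2])
    nlinarith [mul_pos h3 h4]
  obtain ⟨c, hc0, hc⟩ := near
  suffices 0 < e x by simp only [he] at this; linarith
  by_contra hneg
  push Not at hneg
  have hcx : c < x := by
    by_contra hle
    exact absurd (hc x hx (not_lt.1 hle)) (not_lt.2 hneg)
  have hS : IsCompact (Icc c x ∩ {y | e y ≤ 0}) :=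
    isCompact_Icc.inter_right (isClosed_le hec continuous_const)
  obtain ⟨x₀, ⟨⟨hx₀c, hx₀x⟩, hx₀e⟩, hmin⟩ := hS.exists_isLeast ⟨x, ⟨hcx.le, le_rfl⟩, hneg⟩
  have hx₀ : 0 < x₀ := hc0.trans_le hx₀c
  have epos : ∀ y, 0 < y → y < x₀ → 0 < e y := by
    intro y hy hyx
    rcases le_total y c with h | h
    · exact hc y hy h
    · by_contra hn
      exact absurd (hmin ⟨⟨h, hyx.le.trans hx₀x⟩, not_lt.1 hn⟩) (not_le.2 hyx)
  have hdd : ∀ y, HasDerivAt (fun y => Y₁ y - Y₂ y) (e y) y := fun y =>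
    ((h₁.hasDerivAt hH hk y).sub (h₂.hasDerivAt hH hk y)).congr_deriv (by simp only [he]; ring)
  have hmono : MonotoneOn (fun y => Y₁ y - Y₂ y) (Icc 0 x₀) := by
    refine monotoneOn_of_deriv_nonneg (convex_Icc 0 x₀)
      (h₁.cont.sub h₂.cont).continuousOn
      (fun y _ => (hdd y).differentiableAt.differentiableWithinAt) fun y hy => ?_
    rw [interior_Icc] at hy
    rw [(hdd y).deriv]
    exact (epos y hy.1 hy.2).le
  have hle : ∀ y ∈ Icc 0 x₀, Y₂ y ≤ Y₁ y := by
    intro y hy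
    have := hmono ⟨le_rfl, hx₀.le⟩ hy hy.1
    simp only [h₁.zero_eq, h₂.zero_eq] at this
    linarith
  have hK : ∀ y, HasDerivAt (fun y => ∫ s in (0 : ℝ)..y, k s) (k y) y := fun y =>
    intervalIntegral.integral_hasDerivAt_right (hk.cont.intervalIntegrable _ _)
      (hk.cont.stronglyMeasurableAtFilter _ _) hk.cont.continuousAt
  have key := integral_antitone_mul_deriv_nonneg (h := H)
    (ψ := fun y => (∫ s in (0 : ℝ)..Y₁ y, k s) - ∫ s in (0 : ℝ)..Y₂ y, k s)
    (ψ' := fun y => lam₂ * (k (Y₂ y) * ∫ s in (0 : ℝ)..y, H s * k (Y₂ s)) -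
      lam₁ * (k (Y₁ y) * ∫ s in (0 : ℝ)..y, H s * k (Y₁ s))) hx₀.le
    (hH.anti.mono fun y hy => hy.1) (fun y _ => hH.nonneg y)
    (fun y => by
      have d₁ := (hK (Y₁ y)).comp y (h₁.hasDerivAt hH hk y)
      have d₂ := (hK (Y₂ y)).comp y (h₂.hasDerivAt hH hk y)
      exact (d₁.sub d₂).congr_deriv (by ring))
    (by
      have := source_primitive_continuous hH hk h₁.cont
      have := source_primitive_continuous hH hk h₂.cont
      have := h₁.cont; have := h₂.cont; have := hk.cont
      fun_prop)
    (by simp [h₁.zero_eq, h₂.zero_eq])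
    (fun y hy => by
      rw [intervalIntegral.integral_interval_sub_left (hk.cont.intervalIntegrable _ _)
        (hk.cont.intervalIntegrable _ _)]
      exact intervalIntegral.integral_nonneg (hle y hy) fun s _ => hk.nonneg s)
  have iiE : ∀ {lam : ℝ} {Y : ℝ → ℝ}, IsProfile H k m lam Y → IntervalIntegrable
      (fun y => H y * (k (Y y) * ∫ s in (0 : ℝ)..y, H s * k (Y s))) volume 0 x₀ := by
    intro lam Y h
    have c1 := source_primitive_continuous hH hk h.cont
    have c2 := h.cont
    have c3 := hk.cont
    exact (hH.intervalIntegrable 0 x₀).mul_continuousOn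
      (by fun_prop : Continuous _).continuousOn
  have e₁ := h₁.energy hH hk x₀
  have e₂ := h₂.energy hH hk x₀
  have split : ∫ y in (0 : ℝ)..x₀, H y * (lam₂ * (k (Y₂ y) * ∫ s in (0 : ℝ)..y, H s * k (Y₂ s)) -
      lam₁ * (k (Y₁ y) * ∫ s in (0 : ℝ)..y, H s * k (Y₁ s))) =
      lam₂ * (∫ y in (0 : ℝ)..x₀, H y * (k (Y₂ y) * ∫ s in (0 : ℝ)..y, H s * k (Y₂ s))) -
      lam₁ * ∫ y in (0 : ℝ)..x₀, H y * (k (Y₁ y) * ∫ s in (0 : ℝ)..y, H s * k (Y₁ s)) := by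
    rw [← intervalIntegral.integral_const_mul, ← intervalIntegral.integral_const_mul,
      ← intervalIntegral.integral_sub ((iiE h₂).const_mul _) ((iiE h₁).const_mul _)]
    refine intervalIntegral.integral_congr fun y _ => ?_
    ring
  rw [split] at key
  have p₁ := h₁.primitive_pos hH hk hm hx₀
  have p₂ := h₂.primitive_pos hH hk hm hx₀
  change e x₀ ≤ 0 at hx₀e
  simp only [he] at hx₀e
  set P₁ := ∫ s in (0 : ℝ)..x₀, H s * k (Y₁ s)
  set P₂ := ∫ s in (0 : ℝ)..x₀, H s * k (Y₂ s)
  have i1 : lam₁ * P₁ ^ 2 ≤ lam₂ * P₂ ^ 2 := by rw [e₁, e₂]; linarith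
  have i2 : lam₂ * P₂ ≤ lam₁ * P₁ := by linarith
  have l2 : 0 < lam₂ := hl.trans_lt hlt
  have i3 : (lam₂ * P₂) ^ 2 ≤ (lam₁ * P₁) ^ 2 := pow_le_pow_left₀ (by positivity) i2 2
  have i4 : lam₁ * (lam₁ * P₁ ^ 2) ≤ lam₁ * (lam₂ * P₂ ^ 2) := mul_le_mul_of_nonneg_left i1 hl
  have i5 : 0 < (lam₂ - lam₁) * (lam₂ * P₂ ^ 2) :=
    mul_pos (sub_pos.2 hlt) (by positivity)
  nlinarith

theorem half_lt (hH : IsWeight H M) (hk : IsNonlinearity k N) {lam₁ lam₂ : ℝ} {Y₁ Y₂ : ℝ → ℝ}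
    (h₁ : IsProfile H k m lam₁ Y₁) (h₂ : IsProfile H k m lam₂ Y₂) (hm : 0 < m) (hl : 0 ≤ lam₁)
    (hlt : lam₁ < lam₂) : Y₂ (1 / 2) < Y₁ (1 / 2) := by
  have hdd := fun y => (h₁.hasDerivAt hH hk y).sub (h₂.hasDerivAt hH hk y)
  have : StrictMonoOn (Y₁ - Y₂) (Icc 0 (1 / 2)) := by
    refine strictMonoOn_of_deriv_pos (convex_Icc _ _) (h₁.cont.sub h₂.cont).continuousOn
      fun y hy => ?_
    rw [interior_Icc] at hy
    rw [(hdd y).deriv]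
    linarith [slope_lt hH hk h₁ h₂ hm hl hlt hy.1]
  have := this ⟨le_rfl, by norm_num⟩ ⟨by norm_num, le_rfl⟩ (by norm_num : (0 : ℝ) < 1 / 2)
  simp only [Pi.sub_apply, h₁.zero_eq, h₂.zero_eq] at this
  linarith

/-- A profile that is nonnegative up to `1/2` has an explicitly bounded parameter. -/
theorem param_mul_le (hH : IsWeight H M) (hk : IsNonlinearity k N) (h : IsProfile H k m lam Y)
    (hl : 0 ≤ lam) (hY : 0 ≤ Y (1 / 2)) :
    lam * (k (m / 2) * ∫ s in (0 : ℝ)..(1 / 4), H s) ≤ 4 * m := by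
  obtain ⟨ξ, hξ, eξ⟩ := exists_hasDerivAt_eq_slope Y _ (by norm_num : (0 : ℝ) < 1 / 4)
    h.cont.continuousOn fun x _ => h.hasDerivAt hH hk x
  obtain ⟨η, hη, eη⟩ := exists_hasDerivAt_eq_slope Y _ (by norm_num : (1 / 4 : ℝ) < 1 / 2)
    h.cont.continuousOn fun x _ => h.hasDerivAt hH hk x
  have mono := source_primitive_monotone hH hk h.cont
  have m1 := mul_le_mul_of_nonneg_left (mono hξ.2.le) hl
  have m2 := mul_le_mul_of_nonneg_left (mono hη.1.le) hl
  simp only at m1 m2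
  have hz := h.zero_eq
  have d1 : Y (1 / 4) - Y 0 = -(lam * ∫ s in (0 : ℝ)..ξ, H s * k (Y s)) * (1 / 4) := by
    rw [eξ]; ring
  have d2 : Y (1 / 2) - Y (1 / 4) = -(lam * ∫ s in (0 : ℝ)..η, H s * k (Y s)) * (1 / 4) := by
    rw [eη]; ring
  have quarter : m / 2 ≤ Y (1 / 4) := by linarith
  have anti := h.antitoneOn hH hk hl
  have low : k (m / 2) * (∫ s in (0 : ℝ)..(1 / 4), H s) ≤
      ∫ s in (0 : ℝ)..(1 / 4), H s * k (Y s) := by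
    rw [← intervalIntegral.integral_const_mul]
    refine intervalIntegral.integral_mono_on (by norm_num)
      ((hH.intervalIntegrable _ _).const_mul _) (source_intervalIntegrable hH hk h.cont _ _)
      fun s hs => ?_
    rw [mul_comm]
    exact mul_le_mul_of_nonneg_left (hk.mono (quarter.trans
      (anti hs.1 (by norm_num : (0 : ℝ) ≤ 1 / 4) hs.2))) (hH.nonneg s)
  have top := anti (le_refl (0 : ℝ)) (by norm_num : (0 : ℝ) ≤ 1 / 4) (by norm_num)
  have := mul_le_mul_of_nonneg_left low hl
  linarith

theorem nonneg (hH : IsWeight H M) (hk : IsNonlinearity k N) (h : IsProfile H k m lam Y)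
    (hl : 0 ≤ lam) (h1 : Y (1 / 2) = 0) {x : ℝ} (hx : x ∈ Icc (0 : ℝ) (1 / 2)) : 0 ≤ Y x := by
  rw [← h1]
  exact h.antitoneOn hH hk hl hx.1 (by norm_num : (0 : ℝ) ≤ 1 / 2) hx.2

theorem le_center (hH : IsWeight H M) (hk : IsNonlinearity k N) (h : IsProfile H k m lam Y)
    (hl : 0 ≤ lam) {x : ℝ} (hx : 0 ≤ x) : Y x ≤ m := by
  have := h.antitoneOn hH hk hl (le_refl (0 : ℝ)) hx hx
  rwa [h.zero_eq] at this

theorem integral_slope_sq (hH : IsWeight H M) (hk : IsNonlinearity k N)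
    (h : IsProfile H k m lam Y) (h1 : Y (1 / 2) = 0) :
    ∫ x in (0 : ℝ)..(1 / 2), (lam * ∫ s in (0 : ℝ)..x, H s * k (Y s)) ^ 2 =
      lam * ∫ x in (0 : ℝ)..(1 / 2), H x * k (Y x) * Y x := by
  have ii := source_intervalIntegrable hH hk h.cont
  have pc := source_primitive_continuous hH hk h.cont
  have hder : Continuous fun x => -(lam * ∫ s in (0 : ℝ)..x, H s * k (Y s)) := by fun_prop
  have hv : ∀ x, Y x = m + ∫ y in (0 : ℝ)..x, -(lam * ∫ s in (0 : ℝ)..y, H s * k (Y s)) := by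
    intro x
    rw [intervalIntegral.integral_eq_sub_of_hasDerivAt (fun y _ => h.hasDerivAt hH hk y)
      (hder.intervalIntegrable _ _), h.zero_eq]
    ring
  have parts := integral_primitive_mul_add (a := 1 / 2) ii
    (fun a b => hder.intervalIntegrable a b) hv
  rw [h1, mul_zero, intervalIntegral.integral_add ((ii _ _).mul_continuousOn h.cont.continuousOn)
    (Continuous.intervalIntegrable (by fun_prop) _ _)] at parts
  have e : ∫ x in (0 : ℝ)..(1 / 2), (lam * ∫ s in (0 : ℝ)..x, H s * k (Y s)) ^ 2 =
      -lam * ∫ x in (0 : ℝ)..(1 / 2), (∫ s in (0 : ℝ)..x, H s * k (Y s)) *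
        -(lam * ∫ s in (0 : ℝ)..x, H s * k (Y s)) := by
    rw [← intervalIntegral.integral_const_mul]
    refine intervalIntegral.integral_congr fun x _ => ?_
    ring
  rw [e]
  linear_combination (-lam) * parts

theorem center_sq_le (hH : IsWeight H M) (hk : IsNonlinearity k N)
    (h : IsProfile H k m lam Y) (h1 : Y (1 / 2) = 0) :
    2 * m ^ 2 ≤ ∫ x in (0 : ℝ)..(1 / 2), (lam * ∫ s in (0 : ℝ)..x, H s * k (Y s)) ^ 2 := by
  have pc := source_primitive_continuous hH hk h.cont
  have hder : Continuous fun x => -(lam * ∫ s in (0 : ℝ)..x, H s * k (Y s)) := by fun_prop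
  have ftc := intervalIntegral.integral_eq_sub_of_hasDerivAt (a := 0) (b := 1 / 2)
    (fun y _ => h.hasDerivAt hH hk y) (hder.intervalIntegrable _ _)
  rw [h1, h.zero_eq, intervalIntegral.integral_neg] at ftc
  have nn : 0 ≤ ∫ x in (0 : ℝ)..(1 / 2),
      ((lam * ∫ s in (0 : ℝ)..x, H s * k (Y s)) - 2 * m) ^ 2 :=
    intervalIntegral.integral_nonneg (by norm_num) fun x _ => sq_nonneg _
  have e : ∫ x in (0 : ℝ)..(1 / 2), ((lam * ∫ s in (0 : ℝ)..x, H s * k (Y s)) - 2 * m) ^ 2 =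
      (∫ x in (0 : ℝ)..(1 / 2), (lam * ∫ s in (0 : ℝ)..x, H s * k (Y s)) ^ 2) -
      4 * m * (∫ x in (0 : ℝ)..(1 / 2), lam * ∫ s in (0 : ℝ)..x, H s * k (Y s)) +
      ∫ x in (0 : ℝ)..(1 / 2), 4 * m ^ 2 := by
    rw [← intervalIntegral.integral_const_mul, ← intervalIntegral.integral_sub
      (Continuous.intervalIntegrable (by fun_prop) _ _)
      (Continuous.intervalIntegrable (by fun_prop) _ _), ← intervalIntegral.integral_add
      (Continuous.intervalIntegrable (by fun_prop) _ _)
      (Continuous.intervalIntegrable (by fun_prop) _ _)]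
    refine intervalIntegral.integral_congr fun x _ => ?_
    ring
  have ftc' : ∫ x in (0 : ℝ)..(1 / 2), lam * ∫ s in (0 : ℝ)..x, H s * k (Y s) = m := by
    linarith
  rw [e, ftc', intervalIntegral.integral_const, smul_eq_mul] at nn
  linarith

/-- The slope of a profile is concave, hence lies above its chord. -/
theorem primitive_chord (hH : IsWeight H M) (hk : IsNonlinearity k N)
    (h : IsProfile H k m lam Y) (hl : 0 ≤ lam) {x : ℝ} (hx : x ∈ Icc (0 : ℝ) (1 / 2)) :
    2 * x * (∫ s in (0 : ℝ)..(1 / 2), H s * k (Y s)) ≤ ∫ s in (0 : ℝ)..x, H s * k (Y s) := by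
  have ii := source_intervalIntegrable hH hk h.cont
  have qanti : ∀ {s t : ℝ}, 0 ≤ s → s ≤ t → H t * k (Y t) ≤ H s * k (Y s) := by
    intro s t hs hst
    have ht : 0 ≤ t := hs.trans hst
    exact mul_le_mul (hH.anti hs ht hst) (hk.mono (h.antitoneOn hH hk hl hs ht hst))
      (hk.nonneg _) (hH.nonneg _)
  have left : x * (H x * k (Y x)) ≤ ∫ s in (0 : ℝ)..x, H s * k (Y s) := by
    have := intervalIntegral.integral_mono_on hx.1
      (intervalIntegrable_const (c := H x * k (Y x))) (ii 0 x) fun s hs => qanti hs.1 hs.2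
    rwa [intervalIntegral.integral_const, smul_eq_mul, sub_zero] at this
  have right : ∫ s in x..(1 / 2), H s * k (Y s) ≤ (1 / 2 - x) * (H x * k (Y x)) := by
    have := intervalIntegral.integral_mono_on hx.2 (ii x (1 / 2))
      (intervalIntegrable_const (c := H x * k (Y x))) fun s hs => qanti hx.1 hs.1
    rwa [intervalIntegral.integral_const, smul_eq_mul] at this
  have split := intervalIntegral.integral_add_adjacent_intervals (ii 0 x) (ii x (1 / 2))
  rw [← split]
  have := hx.1
  have := hx.2
  nlinarith

/-- The Harnack inequality for profiles vanishing at `1/2`. -/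
theorem harnack (hH : IsWeight H M) (hk : IsNonlinearity k N)
    (h : IsProfile H k m lam Y) (hl : 0 ≤ lam) (h1 : Y (1 / 2) = 0) {x : ℝ}
    (hx : x ∈ Icc (0 : ℝ) (1 / 2)) : (1 / 2 - x) * (2 * x) * Real.sqrt (2 *
      ∫ x in (0 : ℝ)..(1 / 2), (lam * ∫ s in (0 : ℝ)..x, H s * k (Y s)) ^ 2) ≤ Y x := by
  have pc := source_primitive_continuous hH hk h.cont
  have mono := source_primitive_monotone hH hk h.cont
  have pnn : ∀ {x : ℝ}, 0 ≤ x → 0 ≤ lam * ∫ s in (0 : ℝ)..x, H s * k (Y s) :=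
    fun hx => mul_nonneg hl (source_primitive_nonneg hH hk hx)
  have norm_le : Real.sqrt (2 * ∫ x in (0 : ℝ)..(1 / 2),
      (lam * ∫ s in (0 : ℝ)..x, H s * k (Y s)) ^ 2) ≤
      lam * ∫ s in (0 : ℝ)..(1 / 2), H s * k (Y s) := by
    refine Real.sqrt_le_iff.2 ⟨pnn (by norm_num), ?_⟩
    have := intervalIntegral.integral_mono_on (by norm_num : (0 : ℝ) ≤ 1 / 2)
      (μ := volume) (f := fun x => (lam * ∫ s in (0 : ℝ)..x, H s * k (Y s)) ^ 2)
      (Continuous.intervalIntegrable (by fun_prop) _ _) (intervalIntegrable_const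
        (c := (lam * ∫ s in (0 : ℝ)..(1 / 2), H s * k (Y s)) ^ 2)) fun s hs =>
          pow_le_pow_left₀ (pnn hs.1) (mul_le_mul_of_nonneg_left (mono hs.2) hl) 2
    rw [intervalIntegral.integral_const, smul_eq_mul] at this
    linarith
  have chord := mul_le_mul_of_nonneg_left (h.primitive_chord hH hk hl hx) hl
  have hxs : 0 ≤ 2 * x := by linarith [hx.1]
  have hxr : 0 ≤ 1 / 2 - x := by linarith [hx.2]
  have low : (1 / 2 - x) * (lam * ∫ s in (0 : ℝ)..x, H s * k (Y s)) ≤ Y x := by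
    rcases hx.2.eq_or_lt with rfl | hlt
    · rw [h1]; simp
    · obtain ⟨ξ, hξ, eξ⟩ := exists_hasDerivAt_eq_slope Y _ hlt
        h.cont.continuousOn fun x _ => h.hasDerivAt hH hk x
      rw [h1, eq_div_iff (by linarith)] at eξ
      have := mul_le_mul_of_nonneg_left (mul_le_mul_of_nonneg_left (mono hξ.1.le) hl) hxr
      simp only at this
      linarith
  calc _ ≤ (1 / 2 - x) * (2 * x) * (lam * ∫ s in (0 : ℝ)..(1 / 2), H s * k (Y s)) := by
        gcongr
    _ = (1 / 2 - x) * (lam * (2 * x * ∫ s in (0 : ℝ)..(1 / 2), H s * k (Y s))) := by ring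
    _ ≤ _ := mul_le_mul_of_nonneg_left chord hxr
    _ ≤ Y x := low

end IsProfile

end Profile

theorem isProfile_of_volterra {H k Y : ℝ → ℝ} {M N m lam : ℝ} (hH : IsWeight H M)
    (hk : IsNonlinearity k N) (hY : Continuous Y)
    (h : ∀ x, Y x = m - lam * ∫ s in (0 : ℝ)..(1 / 2), max (|x| - s) 0 * (H s * k (Y s))) :
    IsProfile H k m lam Y := by
  have even : ∀ x, Y (-x) = Y x := fun x => by rw [h (-x), h x, abs_neg]
  have ii := source_intervalIntegrable hH hk hY
  have ii' : ∀ a b, IntervalIntegrable (fun s => s * (H s * k (Y s))) volume a b := fun a b =>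
    (ii a b).continuousOn_mul continuousOn_id
  have nonneg_case : ∀ x, 0 ≤ x →
      ∫ s in (0 : ℝ)..(1 / 2), max (x - s) 0 * (H s * k (Y s)) =
      x * (∫ s in (0 : ℝ)..x, H s * k (Y s)) - ∫ s in (0 : ℝ)..x, s * (H s * k (Y s)) := by
    intro x hx
    have jj : ∀ a b, IntervalIntegrable (fun s => max (x - s) 0 * (H s * k (Y s))) volume a b :=
      fun a b => (ii a b).continuousOn_mul (by fun_prop)
    have e1 : ∫ s in (0 : ℝ)..x, max (x - s) 0 * (H s * k (Y s)) =
        x * (∫ s in (0 : ℝ)..x, H s * k (Y s)) - ∫ s in (0 : ℝ)..x, s * (H s * k (Y s)) := by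
      rw [← intervalIntegral.integral_const_mul,
        ← intervalIntegral.integral_sub ((ii 0 x).const_mul x) (ii' 0 x)]
      refine intervalIntegral.integral_congr fun s hs => ?_
      rw [uIcc_of_le hx] at hs
      simp only [max_eq_left (sub_nonneg.2 hs.2)]
      ring
    have e2 : ∫ s in x..(1 / 2), max (x - s) 0 * (H s * k (Y s)) = 0 := by
      refine (intervalIntegral.integral_congr_ae (g := fun _ => (0 : ℝ))
        (Eventually.of_forall fun s hs => ?_)).trans (by simp)
      rcases le_total x (1 / 2) with hx2 | hx2
      · rw [uIoc_of_le hx2] at hs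
        rw [max_eq_right (by linarith [hs.1]), zero_mul]
      · rw [uIoc_of_ge hx2] at hs
        rw [hH.support s hs.1, zero_mul, mul_zero]
    rw [← intervalIntegral.integral_add_adjacent_intervals (jj 0 x) (jj x (1 / 2)), e1, e2,
      add_zero]
  refine ⟨hY, even, fun x => ?_⟩
  rw [h x]
  congr 2
  rcases le_total 0 x with hx | hx
  · rw [abs_of_nonneg hx, nonneg_case x hx]
  · rw [abs_of_nonpos hx, nonneg_case (-x) (by linarith)]
    have o1 : ∫ s in (0 : ℝ)..(-x), H s * k (Y s) = -∫ s in (0 : ℝ)..x, H s * k (Y s) := by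
      have := intervalIntegral.integral_comp_neg (a := 0) (b := x) fun s => H s * k (Y s)
      simp only [hH.even, even, neg_zero] at this
      rw [this, intervalIntegral.integral_symm]
    have o2 : ∫ s in (0 : ℝ)..(-x), s * (H s * k (Y s)) =
        ∫ s in (0 : ℝ)..x, s * (H s * k (Y s)) := by
      have := intervalIntegral.integral_comp_neg (a := 0) (b := x) fun s => s * (H s * k (Y s))
      simp only [hH.even, even, neg_zero, neg_mul, intervalIntegral.integral_neg] at this
      rw [← neg_neg (∫ s in (0 : ℝ)..x, _), this, intervalIntegral.integral_symm]
    rw [o1, o2]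
    ring

/-- If `L > 1` wherever `N` equals `ρ` and `L < 1` wherever `N` equals `σ`, and `N` crosses
from `ρ` to `σ`, then `L = 1` at some point where `N` lies strictly between. -/
theorem exists_eq_one_of_crossing {N L : ℝ → ℝ} {α γ ρ σ : ℝ} (hαγ : α ≤ γ) (hρσ : ρ < σ)
    (hN : ContinuousOn N (Icc α γ)) (hL : ContinuousOn L (Icc α γ))
    (hα : N α ≤ ρ) (hγ : σ ≤ N γ) (h₁ : ∀ m ∈ Icc α γ, N m = ρ → 1 < L m)
    (h₂ : ∀ m ∈ Icc α γ, N m = σ → L m < 1) :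
    ∃ c ∈ Icc α γ, L c = 1 ∧ ρ < N c ∧ N c < σ := by
  have hS : IsCompact (Icc α γ ∩ N ⁻¹' Ici σ) :=
    isCompact_Icc.of_isClosed_subset (hN.preimage_isClosed_of_isClosed isClosed_Icc isClosed_Ici)
      inter_subset_left
  obtain ⟨b, ⟨hbm, hbσ⟩, hbmin⟩ := hS.exists_isLeast ⟨γ, ⟨hαγ, le_rfl⟩, hγ⟩
  have hsub : Icc α b ⊆ Icc α γ := Icc_subset_Icc le_rfl hbm.2
  have below : ∀ m ∈ Icc α b, m < b → N m < σ := fun m hm hmb => by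
    by_contra hn
    exact absurd (hbmin ⟨hsub hm, not_lt.1 hn⟩) (not_le.2 hmb)
  have hNb : N b = σ := by
    obtain ⟨c, hc, hcσ⟩ := intermediate_value_Icc hbm.1 (hN.mono hsub)
      (⟨hα.trans hρσ.le, hbσ⟩ : σ ∈ Icc (N α) (N b))
    rcases hc.2.lt_or_eq with h | h
    · exact absurd hcσ (below c hc h).ne
    · rw [← h, hcσ]
  have hT : IsCompact (Icc α b ∩ N ⁻¹' Iic ρ) :=
    isCompact_Icc.of_isClosed_subset
      ((hN.mono hsub).preimage_isClosed_of_isClosed isClosed_Icc isClosed_Iic) inter_subset_left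
  obtain ⟨a, ⟨ham, haρ⟩, hamax⟩ := hT.exists_isGreatest ⟨α, ⟨le_rfl, hbm.1⟩, hα⟩
  have hsub' : Icc a b ⊆ Icc α b := Icc_subset_Icc ham.1 le_rfl
  have above : ∀ m ∈ Icc a b, a < m → ρ < N m := fun m hm ham' => by
    by_contra hn
    exact absurd (hamax ⟨hsub' hm, not_lt.1 hn⟩) (not_le.2 ham')
  have hNa : N a = ρ := by
    obtain ⟨c, hc, hcρ⟩ := intermediate_value_Icc ham.2 (hN.mono (hsub'.trans hsub))
      (⟨haρ, hρσ.le.trans hbσ⟩ : ρ ∈ Icc (N a) (N b))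
    rcases hc.1.lt_or_eq with h | h
    · exact absurd hcρ (above c hc h).ne'
    · rw [h, hcρ]
  have La := h₁ a (hsub ham) hNa
  have Lb := h₂ b hbm hNb
  obtain ⟨c, hc, hc1⟩ := intermediate_value_Icc' ham.2 (hL.mono (hsub'.trans hsub))
    (⟨Lb.le, La.le⟩ : (1 : ℝ) ∈ Icc (L b) (L a))
  have hca : a < c := hc.1.lt_of_ne fun h => by rw [h, hc1] at La; exact lt_irrefl _ La
  have hcb : c < b := hc.2.lt_of_ne fun h => by rw [← h, hc1] at Lb; exact lt_irrefl _ Lb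
  exact ⟨c, hsub (hsub' hc), hc1, above c hc hca, below c (hsub' hc) hcb⟩

theorem abs_clamp_le {R : ℝ} (hR : 0 ≤ R) (x : ℝ) : |max 0 (min x R)| ≤ R := by
  rw [abs_of_nonneg (le_max_left _ _)]
  exact max_le hR (min_le_right _ _)

theorem clamp_eq {R x : ℝ} (hx : x ∈ Icc 0 R) : max 0 (min x R) = x := by
  rw [min_eq_left hx.2, max_eq_right hx.1]

/-- Shooting from the centre: if nontrivial profiles of squared norm `r ^ 2` have parameter
above `1` and those of squared norm `R ^ 2` have parameter below `1`, there is a profile with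
parameter `1` and norm strictly between. -/
theorem exists_profile_between {H k : ℝ → ℝ} {M N : ℝ} {K : NNReal} (hH : IsWeight H M)
    (hk : IsNonlinearity k N) (hkK : LipschitzWith K k) {r R : ℝ} (hr : 0 < r) (hrR : r < R)
    (small : ∀ m lam Y, IsProfile H k m lam Y → 0 < m → 0 ≤ lam → Y (1 / 2) = 0 →
      2 * ∫ x in (0 : ℝ)..(1 / 2), (lam * ∫ s in (0 : ℝ)..x, H s * k (Y s)) ^ 2 = r ^ 2 → 1 < lam)
    (large : ∀ m lam Y, IsProfile H k m lam Y → 0 < m → 0 ≤ lam → Y (1 / 2) = 0 →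
      2 * ∫ x in (0 : ℝ)..(1 / 2), (lam * ∫ s in (0 : ℝ)..x, H s * k (Y s)) ^ 2 = R ^ 2 →
      lam < 1) :
    ∃ m Y, IsProfile H k m 1 Y ∧ m ≤ R ∧ Y (1 / 2) = 0 ∧
      r ^ 2 < 2 * ∫ x in (0 : ℝ)..(1 / 2), (1 * ∫ s in (0 : ℝ)..x, H s * k (Y s)) ^ 2 ∧
      2 * ∫ x in (0 : ℝ)..(1 / 2), (1 * ∫ s in (0 : ℝ)..x, H s * k (Y s)) ^ 2 < R ^ 2 := by
  have hR : 0 < R := hr.trans hrR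
  have hI : 0 < ∫ s in (0 : ℝ)..(1 / 4), H s := by
    obtain ⟨δ, hδ, hHδ⟩ := hH.pos_of_lt
    have hc : 0 < min δ (1 / 4) := lt_min hδ (by norm_num)
    have h1 : 0 < ∫ s in (0 : ℝ)..min δ (1 / 4), H s :=
      intervalIntegral.intervalIntegral_pos_of_pos_on (hH.intervalIntegrable _ _)
        (fun s hs => hHδ s hs.1.le (hs.2.le.trans (min_le_left _ _))) hc
    have h2 := intervalIntegral.integral_add_adjacent_intervals
      (hH.intervalIntegrable 0 (min δ (1 / 4))) (hH.intervalIntegrable _ (1 / 4))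
    have h3 : 0 ≤ ∫ s in min δ (1 / 4)..(1 / 4), H s :=
      intervalIntegral.integral_nonneg (min_le_right _ _) fun s _ => hH.nonneg s
    linarith
  set I := ∫ s in (0 : ℝ)..(1 / 4), H s with hIdef
  have hk16 : 0 < k (r / 16) := hk.pos _ (by positivity)
  set Λ : ℝ := 4 * R / (k (r / 16) * I) + 1 with hΛ
  have hΛ0 : 0 < Λ := by positivity
  obtain ⟨Y, hYc, hYeq⟩ := exists_continuous_volterra_solution (P := ℝ × ℝ)
    (a := fun p => max 0 (min p.1 R)) (b := fun p => max 0 (min p.2 Λ)) (by fun_prop) (by fun_prop)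
    (fun p => abs_clamp_le hR.le p.1) (fun p => abs_clamp_le hΛ0.le p.2) hH.measurable (M := M)
    (fun x => by rw [abs_of_nonneg (hH.nonneg x)]; exact hH.le x) hkK
    (fun x => by rw [abs_of_nonneg (hk.nonneg x)]; exact hk.le x)
  have prof : ∀ {m lam : ℝ}, m ∈ Icc 0 R → lam ∈ Icc 0 Λ → IsProfile H k m lam (Y (m, lam)) := by
    intro m lam hm hlam
    refine isProfile_of_volterra hH hk (by fun_prop) fun x => ?_
    rw [hYeq]
    simp only [clamp_eq hm, clamp_eq hlam]
  have Sc : Continuous fun p : ℝ × ℝ => Y p (1 / 2) := by fun_prop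
  have mem : ∀ {m : ℝ}, m ∈ Icc (r / 8) R → m ∈ Icc 0 R ∧ 0 < m := fun hm =>
    ⟨⟨by linarith [hm.1], hm.2⟩, by linarith [hm.1]⟩
  have exi : ∀ m ∈ Icc (r / 8) R, ∃ lam ∈ Icc 0 Λ, Y (m, lam) (1 / 2) = 0 := by
    intro m hm
    obtain ⟨hm0, hmpos⟩ := mem hm
    have s0 : 0 ≤ Y (m, 0) (1 / 2) := by
      rw [(prof hm0 ⟨le_rfl, hΛ0.le⟩).eq]
      simpa using hmpos.le
    have s1 : Y (m, Λ) (1 / 2) ≤ 0 := by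
      by_contra hn
      have h1 := (prof hm0 ⟨hΛ0.le, le_rfl⟩).param_mul_le hH hk hΛ0.le (not_le.1 hn).le
      have h2 : k (r / 16) ≤ k (m / 2) := hk.mono (by linarith [hm.1])
      have h3 : Λ * (k (r / 16) * I) ≤ Λ * (k (m / 2) * I) := by gcongr
      have h4 : Λ * (k (r / 16) * I) = 4 * R + k (r / 16) * I := by
        rw [hΛ]; field_simp
      have h5 : 0 < k (r / 16) * I := by positivity
      linarith [hm.2]
    have hc : ContinuousOn (fun lam => Y (m, lam) (1 / 2)) (Icc 0 Λ) :=
      (by fun_prop : Continuous fun lam => Y (m, lam) (1 / 2)).continuousOn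
    obtain ⟨lam, hlam, e⟩ := intermediate_value_Icc' hΛ0.le hc ⟨s1, s0⟩
    exact ⟨lam, hlam, e⟩
  choose! ℓ hℓ hS using exi
  have ℓc : ContinuousOn ℓ (Icc (r / 8) R) := by
    intro m₀ hm₀
    refine tendsto_order.2 ⟨fun a ha => ?_, fun b hb => ?_⟩
    · rcases lt_or_ge a 0 with h0 | h0
      · filter_upwards [self_mem_nhdsWithin] with m hm
        exact h0.trans_le (hℓ m hm).1
      · have haΛ : a ∈ Icc 0 Λ := ⟨h0, ha.le.trans (hℓ m₀ hm₀).2⟩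
        have h1 : 0 < Y (m₀, a) (1 / 2) := by
          rw [← hS m₀ hm₀]
          exact IsProfile.half_lt hH hk (prof (mem hm₀).1 haΛ) (prof (mem hm₀).1 (hℓ m₀ hm₀))
            (mem hm₀).2 h0 ha
        have h2 : ∀ᶠ m in 𝓝 m₀, 0 < Y (m, a) (1 / 2) :=
          (by fun_prop : Continuous fun m => Y (m, a) (1 / 2)).continuousAt.eventually
            (lt_mem_nhds h1)
        filter_upwards [self_mem_nhdsWithin, nhdsWithin_le_nhds h2] with m hm hpos
        by_contra hn
        rcases (not_lt.1 hn).lt_or_eq with h | h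
        · have := IsProfile.half_lt hH hk (prof (mem hm).1 (hℓ m hm)) (prof (mem hm).1 haΛ)
            (mem hm).2 (hℓ m hm).1 h
          rw [hS m hm] at this
          exact lt_asymm this hpos
        · rw [← h, hS m hm] at hpos
          exact lt_irrefl _ hpos
    · rcases lt_or_ge Λ b with h0 | h0
      · filter_upwards [self_mem_nhdsWithin] with m hm
        exact (hℓ m hm).2.trans_lt h0
      · have hbΛ : b ∈ Icc 0 Λ := ⟨(hℓ m₀ hm₀).1.trans hb.le, h0⟩
        have h1 : Y (m₀, b) (1 / 2) < 0 := by
          rw [← hS m₀ hm₀]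
          exact IsProfile.half_lt hH hk (prof (mem hm₀).1 (hℓ m₀ hm₀)) (prof (mem hm₀).1 hbΛ)
            (mem hm₀).2 (hℓ m₀ hm₀).1 hb
        have h2 : ∀ᶠ m in 𝓝 m₀, Y (m, b) (1 / 2) < 0 :=
          (by fun_prop : Continuous fun m => Y (m, b) (1 / 2)).continuousAt.eventually
            (gt_mem_nhds h1)
        filter_upwards [self_mem_nhdsWithin, nhdsWithin_le_nhds h2] with m hm hneg
        by_contra hn
        rcases (not_lt.1 hn).lt_or_eq with h | h
        · have := IsProfile.half_lt hH hk (prof (mem hm).1 hbΛ) (prof (mem hm).1 (hℓ m hm))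
            (mem hm).2 hbΛ.1 h
          rw [hS m hm] at this
          exact lt_asymm this hneg
        · rw [h, hS m hm] at hneg
          exact lt_irrefl _ hneg
  have hkc := hk.cont
  have Jc : Continuous fun p : ℝ × ℝ =>
      ∫ s in (0 : ℝ)..(1 / 2), H s * (k (Y p s) * max 0 (min (Y p s) R)) := by
    refine intervalIntegral.continuous_of_dominated_interval (bound := fun _ => M * (N * R))
      (fun p => ?_) (fun p => Eventually.of_forall fun s _ => ?_) (by simp)
      (Eventually.of_forall fun s _ => by fun_prop)
    · exact (hH.measurable.mul
        (by fun_prop : Continuous fun s => k (Y p s) * max 0 (min (Y p s) R)).measurable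
        ).aestronglyMeasurable
    · rw [norm_mul, norm_mul, Real.norm_eq_abs, Real.norm_eq_abs, abs_of_nonneg (hH.nonneg s),
        abs_of_nonneg (hk.nonneg _)]
      have := (hk.nonneg (Y p s)).trans (hk.le _)
      exact mul_le_mul (hH.le s) (mul_le_mul (hk.le _) (abs_clamp_le hR.le _) (abs_nonneg _) this)
        (mul_nonneg (hk.nonneg _) (abs_nonneg _)) ((hH.nonneg s).trans (hH.le s))
  have normsq : ∀ m ∈ Icc (r / 8) R, 2 * (ℓ m * ∫ s in (0 : ℝ)..(1 / 2),
      H s * (k (Y (m, ℓ m) s) * max 0 (min (Y (m, ℓ m) s) R))) =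
      2 * ∫ x in (0 : ℝ)..(1 / 2), (ℓ m * ∫ s in (0 : ℝ)..x, H s * k (Y (m, ℓ m) s)) ^ 2 := by
    intro m hm
    have hp := prof (mem hm).1 (hℓ m hm)
    rw [hp.integral_slope_sq hH hk (hS m hm)]
    congr 2
    refine intervalIntegral.integral_congr fun s hs => ?_
    rw [uIcc_of_le (by norm_num)] at hs
    rw [clamp_eq ⟨hp.nonneg hH hk (hℓ m hm).1 (hS m hm) hs,
      (hp.le_center hH hk (hℓ m hm).1 hs.1).trans hm.2⟩, mul_assoc]
  have hα : r / 8 ∈ Icc (r / 8) R := ⟨le_rfl, by linarith⟩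
  have hγ : R ∈ Icc (r / 8) R := ⟨by linarith, le_rfl⟩
  obtain ⟨c, hc, hc1, hcr, hcR⟩ := exists_eq_one_of_crossing (N := fun m =>
      2 * (ℓ m * ∫ s in (0 : ℝ)..(1 / 2),
        H s * (k (Y (m, ℓ m) s) * max 0 (min (Y (m, ℓ m) s) R)))) (L := ℓ) (ρ := r ^ 2) (σ := R ^ 2)
    hα.2 (pow_lt_pow_left₀ hrR hr.le two_ne_zero)
    (by
      refine continuousOn_const.mul (ℓc.mul ?_)
      exact Jc.comp_continuousOn (continuousOn_id.prodMk ℓc))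
    ℓc
    (by
      rw [normsq _ hα]
      have hp := prof (mem hα).1 (hℓ _ hα)
      have := hp.harnack hH hk (hℓ _ hα).1 (hS _ hα) (x := 1 / 4) ⟨by norm_num, by norm_num⟩
      have h2 := hp.le_center hH hk (hℓ _ hα).1 (by norm_num : (0 : ℝ) ≤ 1 / 4)
      exact Real.sqrt_le_left hr.le |>.1 (by linarith))
    (by
      rw [normsq _ hγ]
      have hp := prof (mem hγ).1 (hℓ _ hγ)
      have := hp.center_sq_le hH hk (hS _ hγ)
      nlinarith)
    (fun m hm e => small m (ℓ m) _ (prof (mem hm).1 (hℓ m hm)) (mem hm).2 (hℓ m hm).1 (hS m hm)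
      ((normsq m hm).symm.trans e))
    (fun m hm e => large m (ℓ m) _ (prof (mem hm).1 (hℓ m hm)) (mem hm).2 (hℓ m hm).1 (hS m hm)
      ((normsq m hm).symm.trans e))
  have hp := prof (mem hc).1 (hℓ c hc)
  have hz := hS c hc
  have hn := normsq c hc
  rw [hn] at hcr hcR
  rw [hc1] at hp hz hcr hcR
  exact ⟨c, _, hp, hc.2, hz, hcr, hcR⟩

theorem integral_comp_sub_half_of_even {p : ℝ → ℝ} (hp : ∀ x, p (-x) = p x)
    (ii : ∀ a b, IntervalIntegrable p volume a b) :
    ∫ t in (0 : ℝ)..1, p (t - 1 / 2) = 2 * ∫ x in (0 : ℝ)..(1 / 2), p x := by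
  have reflect := intervalIntegral.integral_comp_neg (a := 0) (b := 1 / 2) p
  simp only [hp, neg_zero] at reflect
  rw [intervalIntegral.integral_comp_sub_right p, show (0 : ℝ) - 1 / 2 = -(1 / 2) by norm_num,
    show (1 : ℝ) - 1 / 2 = 1 / 2 by norm_num,
    ← intervalIntegral.integral_add_adjacent_intervals (b := 0) (ii _ _) (ii _ _), ← reflect]
  ring

section Localization

variable {H k Y : ℝ → ℝ} {M N m lam : ℝ}

namespace IsProfile

theorem weighted_intervalIntegrable (hH : IsWeight H M) (hk : IsNonlinearity k N)
    (h : IsProfile H k m lam Y) (a b : ℝ) :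
    IntervalIntegrable (fun x => H x * k (Y x) * Y x) volume a b :=
  (source_intervalIntegrable hH hk h.cont a b).mul_continuousOn h.cont.continuousOn

/-- Profiles of small norm have parameter above `1`. -/
theorem one_lt_param (hH : IsWeight H M) (hk : IsNonlinearity k N) (h : IsProfile H k m lam Y)
    (hl : 0 ≤ lam) (h1 : Y (1 / 2) = 0) {r A : ℝ} (hr : 0 < r) (hA : 0 < A)
    (hHA : 2 * ∫ x in (0 : ℝ)..(1 / 2), H x ^ 2 = A ^ 2) (hkr : k r / r < Real.pi / A)
    (hn : 2 * ∫ x in (0 : ℝ)..(1 / 2), (lam * ∫ s in (0 : ℝ)..x, H s * k (Y s)) ^ 2 = r ^ 2) :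
    1 < lam := by
  have pc := source_primitive_continuous hH hk h.cont
  have hkr0 := hk.pos r hr
  rw [div_lt_div_iff₀ hr hA] at hkr
  obtain ⟨c, hc1, hc2⟩ := exists_between ((div_lt_iff₀ hr).2 hkr)
  have hc0 : 0 < c := lt_trans (by positivity) hc1
  rw [div_lt_iff₀ hr] at hc1
  have wirt := wirtinger_half (h.hasDerivAt hH hk) (by fun_prop) h1 hc0.le hc2
  simp only [neg_sq] at wirt
  have center := h.center_sq_le hH hk h1
  have hmr : m ≤ r := by nlinarith
  have slope := h.integral_slope_sq hH hk h1
  have iH := hH.intervalIntegrable 0 (1 / 2)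
  have iH2 := hH.sq_intervalIntegrable 0 (1 / 2)
  have iY2 : IntervalIntegrable (fun x => Y x ^ 2) volume 0 (1 / 2) :=
    (h.cont.pow 2).intervalIntegrable _ _
  have iHY : IntervalIntegrable (fun x => H x * Y x) volume 0 (1 / 2) :=
    iH.mul_continuousOn h.cont.continuousOn
  have le1 : ∫ x in (0 : ℝ)..(1 / 2), H x * k (Y x) * Y x ≤
      k r * ∫ x in (0 : ℝ)..(1 / 2), H x * Y x := by
    rw [← intervalIntegral.integral_const_mul]
    refine intervalIntegral.integral_mono_on (by norm_num)
      (h.weighted_intervalIntegrable hH hk _ _) (iHY.const_mul _) fun x hx => ?_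
    have hkY : k (Y x) ≤ k r := hk.mono ((h.le_center hH hk hl hx.1).trans hmr)
    have := mul_le_mul_of_nonneg_right hkY (mul_nonneg (hH.nonneg x) (h.nonneg hH hk hl h1 hx))
    linarith
  have le2 : 2 * (c * A * r) * ∫ x in (0 : ℝ)..(1 / 2), H x * Y x ≤
      r ^ 2 * (∫ x in (0 : ℝ)..(1 / 2), H x ^ 2) +
        (c * A) ^ 2 * ∫ x in (0 : ℝ)..(1 / 2), Y x ^ 2 := by
    rw [← intervalIntegral.integral_const_mul, ← intervalIntegral.integral_const_mul,
      ← intervalIntegral.integral_const_mul,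
      ← intervalIntegral.integral_add (iH2.const_mul _) (iY2.const_mul _)]
    refine intervalIntegral.integral_mono_on (by norm_num) (iHY.const_mul _)
      ((iH2.const_mul _).add (iY2.const_mul _)) fun x _ => ?_
    nlinarith [sq_nonneg (r * H x - c * A * Y x)]
  set S := ∫ x in (0 : ℝ)..(1 / 2), (lam * ∫ s in (0 : ℝ)..x, H s * k (Y s)) ^ 2
  set W := ∫ x in (0 : ℝ)..(1 / 2), H x * k (Y x) * Y x
  set U := ∫ x in (0 : ℝ)..(1 / 2), H x * Y x
  set V := ∫ x in (0 : ℝ)..(1 / 2), Y x ^ 2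
  have le3 : 2 * (c * A * r) * U ≤ r ^ 2 * A ^ 2 := by
    have := mul_le_mul_of_nonneg_left wirt (sq_nonneg A)
    nlinarith
  have le4 : 2 * c * U ≤ r * A := by
    have : 0 < A * r := by positivity
    nlinarith
  by_contra hle
  have hle := not_lt.1 hle
  have W0 : 0 ≤ W := intervalIntegral.integral_nonneg (by norm_num) fun x hx =>
    mul_nonneg (source_nonneg hH hk x) (h.nonneg hH hk hl h1 hx)
  have a1 : r ^ 2 ≤ 2 * W := by nlinarith
  have a2 : c * r ^ 2 ≤ k r * (2 * c * U) := by nlinarith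
  have a3 : k r * (2 * c * U) ≤ k r * (r * A) := mul_le_mul_of_nonneg_left le4 hkr0.le
  nlinarith

/-- Profiles of large norm have parameter below `1`. -/
theorem param_lt_one (hH : IsWeight H M) (hk : IsNonlinearity k N) (h : IsProfile H k m lam Y)
    (hl : 0 ≤ lam) (h1 : Y (1 / 2) = 0) {R β : ℝ} (hR : 0 < R) (hβ : β ∈ Ioo (0 : ℝ) (1 / 4))
    (hC : 0 < ∫ x in (0 : ℝ)..(1 / 2 - β), H x)
    (hkR : 1 / (2 * phi β * ∫ x in (0 : ℝ)..(1 / 2 - β), H x) < k (R * phi β) / R)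
    (hn : 2 * ∫ x in (0 : ℝ)..(1 / 2), (lam * ∫ s in (0 : ℝ)..x, H s * k (Y s)) ^ 2 = R ^ 2) :
    lam < 1 := by
  obtain ⟨hβ0, hβ1⟩ := hβ
  have hφ : 0 < phi β := mul_pos hβ0 (by linarith)
  have harn := h.harnack hH hk hl h1 (x := 1 / 2 - β) ⟨by linarith, by linarith⟩
  rw [hn, Real.sqrt_sq hR.le] at harn
  have low : R * phi β ≤ Y (1 / 2 - β) := by rw [phi]; linarith
  have ii := h.weighted_intervalIntegrable hH hk
  have slope := h.integral_slope_sq hH hk h1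
  have split := intervalIntegral.integral_add_adjacent_intervals (ii 0 (1 / 2 - β))
    (ii (1 / 2 - β) (1 / 2))
  have tail : 0 ≤ ∫ x in (1 / 2 - β)..(1 / 2), H x * k (Y x) * Y x :=
    intervalIntegral.integral_nonneg (by linarith) fun x hx =>
      mul_nonneg (source_nonneg hH hk x)
        (h.nonneg hH hk hl h1 ⟨by linarith [hx.1], hx.2⟩)
  have main : (k (R * phi β) * (R * phi β)) * (∫ x in (0 : ℝ)..(1 / 2 - β), H x) ≤
      ∫ x in (0 : ℝ)..(1 / 2 - β), H x * k (Y x) * Y x := by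
    rw [← intervalIntegral.integral_const_mul]
    refine intervalIntegral.integral_mono_on (by linarith)
      ((hH.intervalIntegrable _ _).const_mul _) (ii _ _) fun x hx => ?_
    have hY : R * phi β ≤ Y x := low.trans
      (h.antitoneOn hH hk hl hx.1 (hx.1.trans hx.2) hx.2)
    have := mul_le_mul_of_nonneg_left (mul_le_mul (hk.mono hY) hY (by positivity) (hk.nonneg _))
      (hH.nonneg x)
    linarith
  set C := ∫ x in (0 : ℝ)..(1 / 2 - β), H x
  rw [div_lt_div_iff₀ (by positivity) hR, one_mul] at hkR
  by_contra hle
  have hle := not_lt.1 hle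
  set W := ∫ x in (0 : ℝ)..(1 / 2), H x * k (Y x) * Y x
  have W0 : 0 ≤ W := by
    have : 0 ≤ (k (R * phi β) * (R * phi β)) * C :=
      mul_nonneg (mul_nonneg (hk.nonneg _) (by positivity)) hC.le
    linarith
  have a1 : 2 * W ≤ R ^ 2 := by rw [← hn, slope]; nlinarith
  nlinarith

theorem integral_green (hH : IsWeight H M) (hk : IsNonlinearity k N) (h : IsProfile H k m 1 Y)
    (h1 : Y (1 / 2) = 0) {t : ℝ} (ht : t ∈ Icc (0 : ℝ) 1) :
    ∫ s in (0 : ℝ)..1, G t s * (H (s - 1 / 2) * k (Y (s - 1 / 2))) = Y (t - 1 / 2) := by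
  set q : ℝ → ℝ := fun s => H s * k (Y s) with hq
  have ii : ∀ a b, IntervalIntegrable q volume a b := source_intervalIntegrable hH hk h.cont
  have jj : ∀ a b, IntervalIntegrable (fun s => s * q s) volume a b := fun a b =>
    (ii a b).continuousOn_mul continuousOn_id
  have qeven : ∀ s, q (-s) = q s := fun s => by simp only [hq, hH.even, h.even]
  have shift := intervalIntegral.integral_comp_sub_right (a := 0) (b := 1)
    (fun s => G t (s + 1 / 2) * q s) (1 / 2)
  simp only [sub_add_cancel] at shift
  rw [shift]
  obtain ⟨x, rfl⟩ : ∃ x, t = x + 1 / 2 := ⟨t - 1 / 2, by ring⟩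
  have hx0 : -(1 / 2) ≤ x := by linarith [ht.1]
  have hx1 : x ≤ 1 / 2 := by linarith [ht.2]
  have left : ∀ s ∈ uIcc (-(1 / 2)) x, G (x + 1 / 2) (s + 1 / 2) * q s =
      (1 / 2 - x) * (1 / 2 * q s + s * q s) := by
    intro s hs
    rw [uIcc_of_le hx0] at hs
    rw [G, if_pos (by linarith [hs.2])]
    ring
  have right : ∀ s ∈ uIcc x (1 / 2), G (x + 1 / 2) (s + 1 / 2) * q s =
      (1 / 2 + x) * (1 / 2 * q s - s * q s) := by
    intro s hs
    rw [uIcc_of_le hx1] at hs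
    rw [G]
    split_ifs with hle
    · obtain rfl : s = x := by linarith [hs.1]
      ring
    · ring
  have il : IntervalIntegrable (fun s => G (x + 1 / 2) (s + 1 / 2) * q s) volume (-(1 / 2)) x :=
    ((((ii _ _).const_mul _).add (jj _ _)).const_mul _).congr fun s hs =>
      (left s (uIoc_subset_uIcc hs)).symm
  have ir : IntervalIntegrable (fun s => G (x + 1 / 2) (s + 1 / 2) * q s) volume x (1 / 2) :=
    ((((ii _ _).const_mul _).sub (jj _ _)).const_mul _).congr fun s hs =>
      (right s (uIoc_subset_uIcc hs)).symm
  have bounds : ((0 : ℝ) - 1 / 2 = -(1 / 2)) ∧ ((1 : ℝ) - 1 / 2 = 1 / 2) := by norm_num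
  rw [bounds.1, bounds.2, ← intervalIntegral.integral_add_adjacent_intervals il ir,
    intervalIntegral.integral_congr left, intervalIntegral.integral_congr right,
    intervalIntegral.integral_const_mul, intervalIntegral.integral_const_mul,
    intervalIntegral.integral_add ((ii _ _).const_mul _) (jj _ _),
    intervalIntegral.integral_sub ((ii _ _).const_mul _) (jj _ _),
    intervalIntegral.integral_const_mul, intervalIntegral.integral_const_mul,
    ← intervalIntegral.integral_interval_sub_left (ii 0 x) (ii 0 (-(1 / 2))),
    ← intervalIntegral.integral_interval_sub_left (jj 0 x) (jj 0 (-(1 / 2))),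
    ← intervalIntegral.integral_interval_sub_left (ii 0 (1 / 2)) (ii 0 x),
    ← intervalIntegral.integral_interval_sub_left (jj 0 (1 / 2)) (jj 0 x)]
  have o1 : ∫ s in (0 : ℝ)..(-(1 / 2)), q s = -∫ s in (0 : ℝ)..(1 / 2), q s := by
    have := intervalIntegral.integral_comp_neg (a := 0) (b := 1 / 2) q
    simp only [qeven, neg_zero] at this
    rw [this, intervalIntegral.integral_symm]
  have o2 : ∫ s in (0 : ℝ)..(-(1 / 2)), s * q s = ∫ s in (0 : ℝ)..(1 / 2), s * q s := by
    have := intervalIntegral.integral_comp_neg (a := 0) (b := 1 / 2) fun s => s * q s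
    simp only [qeven, neg_zero, neg_mul, intervalIntegral.integral_neg] at this
    rw [intervalIntegral.integral_symm, ← this, neg_neg]
  have e1 := h.eq (1 / 2)
  rw [h1] at e1
  rw [o1, o2, add_sub_cancel_right, h.eq x]
  linear_combination e1

theorem normH_shift (hH : IsWeight H M) (hk : IsNonlinearity k N) (h : IsProfile H k m lam Y) :
    normH (fun t => Y (t - 1 / 2)) = Real.sqrt (2 *
      ∫ x in (0 : ℝ)..(1 / 2), (lam * ∫ s in (0 : ℝ)..x, H s * k (Y s)) ^ 2) := by
  have pc := source_primitive_continuous hH hk h.cont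
  set p : ℝ → ℝ := fun x => (lam * ∫ s in (0 : ℝ)..x, H s * k (Y s)) ^ 2 with hp
  have pcont : Continuous p := by fun_prop
  have peven : ∀ x, p (-x) = p x := by
    intro x
    have := intervalIntegral.integral_comp_neg (a := 0) (b := x) fun s => H s * k (Y s)
    simp only [hH.even, h.even, neg_zero] at this
    simp only [hp]
    rw [this, intervalIntegral.integral_symm, mul_neg, neg_sq]
  have hd : ∀ t, deriv (fun t => Y (t - 1 / 2)) t ^ 2 = p (t - 1 / 2) := by
    intro t
    rw [((h.hasDerivAt hH hk (t - 1 / 2)).comp_sub_const t (1 / 2)).deriv, neg_sq]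
  rw [normH]
  congr 1
  simp only [hd]
  exact integral_comp_sub_half_of_even peven fun a b => pcont.intervalIntegrable a b

theorem memK_shift (hH : IsWeight H M) (hk : IsNonlinearity k N) (h : IsProfile H k m lam Y)
    (hl : 0 ≤ lam) (h1 : Y (1 / 2) = 0) : memK fun t => Y (t - 1 / 2) := by
  have hd := fun t => (h.hasDerivAt hH hk (t - 1 / 2)).comp_sub_const t (1 / 2)
  have pc := source_primitive_continuous hH hk h.cont
  have reflect : ∀ t, Y (t - 1 / 2) = Y (1 / 2 - t) := fun t => by
    rw [← h.even, neg_sub]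
  refine ⟨fun t _ => (hd t).differentiableAt, ?_, ?_, ?_, fun t _ => ?_, ?_, fun t ht => ?_⟩
  · rw [show deriv (fun t => Y (t - 1 / 2)) = _ from funext fun t => (hd t).deriv]
    exact (by fun_prop : Continuous _).continuousOn
  · simp only [reflect, sub_zero, h1]
  · simp only [show (1 : ℝ) - 1 / 2 = 1 / 2 by norm_num, h1]
  · simp only [reflect t]
    congr 1
    ring
  · intro s hs t ht hst
    simp only [reflect]
    exact h.antitoneOn hH hk hl (sub_nonneg.2 ht.2) (sub_nonneg.2 hs.2) (by linarith)
  · rw [h.normH_shift hH hk, phi]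
    beta_reduce
    rw [reflect]
    have := h.harnack hH hk hl h1 (x := 1 / 2 - t) ⟨by linarith [ht.2], by linarith [ht.1]⟩
    convert this using 2
    ring

end IsProfile

end Localization

/-- A weight on `[0, 1]`, symmetric about `1 / 2`, recentred at `0` and extended by zero. -/
noncomputable def recentred (g : ℝ → ℝ) (x : ℝ) : ℝ := if |x| ≤ 1 / 2 then g (1 / 2 - |x|) else 0

section Recentred

variable {g : ℝ → ℝ} {β : ℝ}

theorem recentred_of_mem {x : ℝ} (hx : x ∈ Icc (0 : ℝ) (1 / 2)) :
    recentred g x = g (1 / 2 - x) := by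
  rw [recentred, abs_of_nonneg hx.1, if_pos hx.2]

theorem recentred_sub_half (hgsymm : ∀ t ∈ Icc (0 : ℝ) (1 / 2), g t = g (1 - t)) {t : ℝ}
    (ht : t ∈ Icc (0 : ℝ) 1) : recentred g (t - 1 / 2) = g t := by
  rw [recentred, if_pos (abs_le.2 ⟨by linarith [ht.1], by linarith [ht.2]⟩)]
  rcases le_total t (1 / 2) with h | h
  · rw [abs_of_nonpos (by linarith)]
    congr 1
    ring
  · rw [abs_of_nonneg (by linarith), hgsymm _ ⟨by linarith [ht.2], by linarith⟩]
    congr 1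
    ring

theorem integral_recentred (hβ : β ∈ Icc (0 : ℝ) (1 / 2)) :
    ∫ x in (0 : ℝ)..(1 / 2 - β), recentred g x = ∫ t in β..(1 / 2), g t := by
  have := intervalIntegral.integral_comp_sub_left (a := 0) (b := 1 / 2 - β) g (1 / 2)
  rw [sub_zero, sub_sub_cancel] at this
  rw [← this]
  refine intervalIntegral.integral_congr fun x hx => ?_
  rw [uIcc_of_le (by linarith [hβ.2])] at hx
  exact recentred_of_mem ⟨hx.1, by linarith [hx.2, hβ.1]⟩

theorem isWeight_recentred {M : ℝ} (hg0 : ∀ t ∈ Icc (0 : ℝ) 1, 0 ≤ g t)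
    (hgM : ∀ t ∈ Icc (0 : ℝ) 1, g t ≤ M) (hgmeas : Measurable g)
    (hgmono : MonotoneOn g (Icc (0 : ℝ) (1 / 2))) (hβ : β ∈ Icc (0 : ℝ) (1 / 2))
    (hpos : 0 < ∫ t in β..(1 / 2), g t) : IsWeight (recentred g) M := by
  have nonneg : ∀ x, 0 ≤ recentred g x := by
    intro x
    rw [recentred]
    split_ifs with h
    · exact hg0 _ ⟨by linarith, by linarith [abs_nonneg x]⟩
    · exact le_rfl
  refine ⟨?_, nonneg, fun x => ?_, fun x => ?_, fun x hx y hy hxy => ?_, fun x hx => ?_, ?_⟩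
  · exact Measurable.ite (measurableSet_le measurable_norm measurable_const)
      (hgmeas.comp (measurable_const.sub measurable_norm)) measurable_const
  · rw [recentred]
    split_ifs with h
    · exact hgM _ ⟨by linarith, by linarith [abs_nonneg x]⟩
    · exact (hg0 0 (by norm_num)).trans (hgM 0 (by norm_num))
  · rw [recentred, recentred, abs_neg]
  · have hx : 0 ≤ x := hx
    rcases le_or_gt y (1 / 2) with h | h
    · rw [recentred_of_mem ⟨hx, hxy.trans h⟩, recentred_of_mem ⟨hx.trans hxy, h⟩]
      exact hgmono ⟨by linarith, by linarith⟩ ⟨by linarith, by linarith⟩ (by linarith)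
    · rw [recentred, abs_of_nonneg (hx.trans hxy), if_neg (not_le.2 h)]
      exact nonneg x
  · rw [recentred, abs_of_pos (by linarith), if_neg (not_le.2 hx)]
  · by_contra! hn
    have : ∫ x in (0 : ℝ)..(1 / 2 - β), recentred g x ≤ 0 := by
      rw [intervalIntegral.integral_of_le (by linarith [hβ.2])]
      exact setIntegral_nonpos measurableSet_Ioc fun x hx => hn x hx.1
    rw [integral_recentred hβ] at this
    exact absurd hpos (not_lt.2 this)

theorem two_mul_integral_recentred_sq {M : ℝ} (hH : IsWeight (recentred g) M)
    (hgsymm : ∀ t ∈ Icc (0 : ℝ) (1 / 2), g t = g (1 - t)) :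
    2 * ∫ x in (0 : ℝ)..(1 / 2), recentred g x ^ 2 = ∫ t in (0 : ℝ)..1, g t ^ 2 := by
  have e : ∫ t in (0 : ℝ)..1, g t ^ 2 = ∫ t in (0 : ℝ)..1, recentred g (t - 1 / 2) ^ 2 := by
    refine intervalIntegral.integral_congr fun t ht => ?_
    rw [uIcc_of_le zero_le_one] at ht
    simp only [recentred_sub_half hgsymm ht]
  rw [e]
  exact (integral_comp_sub_half_of_even (fun x => by rw [hH.even])
    fun a b => hH.sq_intervalIntegrable a b).symm

end Recentred

section Truncation

variable {f : ℝ → ℝ} {R : ℝ}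

theorem clamp_mem (hR : 0 ≤ R) (x : ℝ) : max 0 (min x R) ∈ Icc 0 R :=
  ⟨le_max_left _ _, max_le hR (min_le_right _ _)⟩

theorem isNonlinearity_truncation (hf : Continuous f) (hfmono : MonotoneOn f (Ici (0 : ℝ)))
    (hf0 : 0 ≤ f 0) (hfpos : ∀ t : ℝ, 0 < t → 0 < f t) (hR : 0 < R) :
    IsNonlinearity (fun x => f (max 0 (min x R))) (f R) where
  cont := by fun_prop
  mono x y hxy := hfmono (clamp_mem hR.le x).1 (clamp_mem hR.le y).1
    (max_le_max le_rfl (min_le_min hxy le_rfl))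
  nonneg x := hf0.trans (hfmono (le_refl (0 : ℝ)) (clamp_mem hR.le x).1 (clamp_mem hR.le x).1)
  le x := hfmono (clamp_mem hR.le x).1 hR.le (clamp_mem hR.le x).2
  pos x hx := hfpos _ (lt_max_of_lt_right (lt_min hx hR))

theorem exists_lipschitzWith_truncation (hf : ContDiff ℝ 1 f) (hR : 0 ≤ R) :
    ∃ K, LipschitzWith K fun x => f (max 0 (min x R)) := by
  obtain ⟨K, hK⟩ := hf.contDiffOn.exists_lipschitzOnWith one_ne_zero (convex_Icc 0 R)
    isCompact_Icc
  have hc : LipschitzWith 1 fun x : ℝ => max 0 (min x R) :=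
    (LipschitzWith.id.min_const R).const_max 0
  refine ⟨K * 1, lipschitzOnWith_univ.1 ?_⟩
  exact hK.comp (lipschitzOnWith_univ.2 hc) fun x _ => clamp_mem hR x

end Truncation

/-- Under (H1) and (H3), the Dirichlet problem `-u'' = g f(u)`,
`u(0) = u(1) = 0`, has a positive symmetric solution localized in the annular
conical set `{ u ∈ K : r < ‖u‖ < R }`. -/
theorem dirichlet_solution_of_H1_H3
    (f : ℝ → ℝ) (hf : ContDiff ℝ 1 f)
    (hfmono : MonotoneOn f (Ici (0:ℝ)))
    (hf0 : 0 ≤ f 0) (hfpos : ∀ t : ℝ, 0 < t → 0 < f t)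
    (g : ℝ → ℝ) (hgnonneg : ∀ t ∈ Icc (0:ℝ) 1, 0 ≤ g t)
    (hgbdd : ∃ M : ℝ, ∀ t ∈ Icc (0:ℝ) 1, g t ≤ M)
    (hgmeas : Measurable g)
    (hgmono : MonotoneOn g (Icc (0:ℝ) (1/2)))
    (hgsymm : ∀ t ∈ Icc (0:ℝ) (1/2), g t = g (1 - t))
    (r R : ℝ) (hr : 0 < r) (hrR : r < R)
    (β : ℝ) (hβ : β ∈ Ioo (0:ℝ) (1/4))
    (Atil Btil Ctil : ℝ)
    (hAtil : Atil = Real.sqrt (∫ t in (0:ℝ)..1, g t ^ 2))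
    (hBtil : Btil = ∫ t in (0:ℝ)..β, g t)
    (hCtil : Ctil = ∫ t in β..(1/2:ℝ), g t)
    -- condition (H1)
    (hApos : 0 < Atil) (hCpos : 0 < Ctil)
    (hH1r : f r / r < Real.pi / Atil)
    (hH1R : f (R * phi β) / R > 1 / (2 * phi β * Ctil))
    -- condition (H3)
    (μ lam : ℝ) (hμ : 1 < μ) (hlam : 0 < lam)
    (hAR : ∀ t ∈ Icc (r * phi β) R, 0 ≤ t * deriv f t - μ * f t)
    (hf'lam : ∀ t ∈ Icc (r * phi β) R, lam ≤ deriv f t)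
    (hBC : Btil * f (r * phi β) < lam * Ctil * (1 - 1 / μ) * (r * phi β)) :
    ∃ u : ℝ → ℝ, memK u ∧ r < normH u ∧ normH u < R ∧
      ∀ t ∈ Icc (0:ℝ) 1, u t = ∫ s in (0:ℝ)..1, G t s * f (u s) * g s := by
  have hR : 0 < R := hr.trans hrR
  obtain ⟨M, hM⟩ := hgbdd
  have hβ' : β ∈ Icc (0 : ℝ) (1 / 2) := ⟨hβ.1.le, by linarith [hβ.2]⟩
  have hφ0 : 0 < phi β := mul_pos hβ.1 (by linarith [hβ.2])
  have hφ1 : phi β ≤ 1 := by rw [phi]; nlinarith [hβ.1, hβ.2]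
  have hH := isWeight_recentred hgnonneg hM hgmeas hgmono hβ' (hCtil ▸ hCpos)
  have hk := isNonlinearity_truncation hf.continuous hfmono hf0 hfpos hR
  obtain ⟨K, hK⟩ := exists_lipschitzWith_truncation hf hR.le
  have hA : 2 * ∫ x in (0 : ℝ)..(1 / 2), recentred g x ^ 2 = Atil ^ 2 := by
    rw [two_mul_integral_recentred_sq hH hgsymm, hAtil, Real.sq_sqrt]
    exact intervalIntegral.integral_nonneg zero_le_one fun t _ => sq_nonneg _
  have hC : ∫ x in (0 : ℝ)..(1 / 2 - β), recentred g x = Ctil :=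
    (integral_recentred hβ').trans hCtil.symm
  obtain ⟨m, Y, hY, hmR, hY1, hlow, hupp⟩ := exists_profile_between hH hk hK hr hrR
    (fun m lam Y hY _ hl hY1 hn => hY.one_lt_param hH hk hl hY1 hr hApos hA
      (by rwa [clamp_eq ⟨hr.le, hrR.le⟩]) hn)
    (fun m lam Y hY _ hl hY1 hn => hY.param_lt_one hH hk hl hY1 hR hβ (by rwa [hC])
      (by rwa [hC, clamp_eq ⟨by positivity, by nlinarith⟩]) hn)
  refine ⟨fun t => Y (t - 1 / 2), hY.memK_shift hH hk zero_le_one hY1, ?_, ?_, fun t ht => ?_⟩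
  · rw [hY.normH_shift hH hk]
    exact Real.lt_sqrt_of_sq_lt hlow
  · rw [hY.normH_shift hH hk]
    exact (Real.sqrt_lt' hR).2 hupp
  · refine (hY.integral_green hH hk hY1 ht).symm.trans
      (intervalIntegral.integral_congr fun s hs => ?_)
    rw [uIcc_of_le zero_le_one] at hs
    have hYs : Y (s - 1 / 2) ∈ Icc 0 R := by
      have habs : Y (s - 1 / 2) = Y |s - 1 / 2| := by
        rcases abs_choice (s - 1 / 2) with h | h
        · rw [h]
        · rw [h, hY.even]
      have hmem : |s - 1 / 2| ∈ Icc (0 : ℝ) (1 / 2) :=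
        ⟨abs_nonneg _, abs_le.2 ⟨by linarith [hs.1], by linarith [hs.2]⟩⟩
      rw [habs]
      exact ⟨hY.nonneg hH hk zero_le_one hY1 hmem,
        (hY.le_center hH hk zero_le_one hmem.1).trans hmR⟩
    simp only [recentred_sub_half hgsymm hs, clamp_eq hYs]
    ring
end
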